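/- Equidistribution of backward orbits (Theorem C, parts (a) and (b)): Let (X,d) be a compact metric space, T an open, strongly transitive, distance-expanding correspondence on X, φ : O₂(T) → ℝ Hölder continuous with respect to d₂, and let μ_φ be the unique Borel probability measure such that (μ_φ,Q) is an equilibrium state for T and φ for some transition probability kernel Q supported by T. For x ∈ X and n ∈ ℕ set O_{−n}(x) := {(y₀,…,y_n) ∈ X^{n+1} : y_n = x and y_k ∈ T(y_{k−1}) for 1 ≤ k ≤ n} (a finite set, since distance-expanding correspondences are forward expansive) and Z_n(x) := Σ_{(y₀,…,y_n)∈O_{−n}(x)} exp(Σ_{i=0}^{n−1} φ(y_i,y_{i+1})). Then: (a) for every x ∈ X, the Borel probability measures (1/Z_n(x)) Σ_{(y₀,…,y_n)∈O_{−n}(x)} ((Σ_{j=0}^{n} δ_{y_j})/(n+1))·exp(Σ_{i=0}^{n−1} φ(y_i,y_{i+1})) converge to μ_φ in the weak* topology as n → ∞; (b) if moreover T is topologically exact, then for every x ∈ X the Borel probability measures (1/Z_n(x)) Σ_{(y₀,…,y_n)∈O_{−n}(x)} δ_{y₀}·exp(Σ_{i=0}^{n−1} φ(y_i,y_{i+1}))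 converge in the weak* topology as n → ∞ to m_φ := ν∘π₁^{−1}, where π₁(x₁,x₂,…) := x₁ and ν is the unique Borel probability measure on O_ω(T) satisfying L_{φ̃}^* ν = exp(P(T,φ))·ν. -/

import Mathlib

open Filter MeasureTheory Set
open scoped Topology ENNReal Classical

namespace Corr

variable {X : Type*}

/-- `T` is a correspondence on `X`: each `T x` is a nonempty closed subset of `X`
and the graph `O₂(T)` is closed in `X × X`. -/
def IsCorrespondence [MetricSpace X] (T : X → Set X) : Prop :=
  (∀ x, (T x).Nonempty) ∧ (∀ x, IsClosed (T x)) ∧ IsClosed {p : X × X | p.2 ∈ T p.1}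

/-- The graph `O₂(T) = {(x₁,x₂) : x₂ ∈ T x₁}`. -/
def graph2 (T : X → Set X) : Set (X × X) := {p | p.2 ∈ T p.1}

/-- The orbit space `O_ω(T)` (0-indexed sequences). -/
def orbitSpace (T : X → Set X) : Set (ℕ → X) := {x | ∀ k, x (k + 1) ∈ T (x k)}

/-- `x : Fin (n+1) → X` is an element of `O_{n+1}(T)`. -/
def IsFinOrbit (T : X → Set X) {n : ℕ} (x : Fin (n + 1) → X) : Prop :=
  ∀ i : Fin n, x i.succ ∈ T (x i.castSucc)

/-- `O_{n+1}(T)` as a subset of `Fin (n+1) → X` (with the sup metric). -/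
def finOrbits (T : X → Set X) (n : ℕ) : Set (Fin (n + 1) → X) := {x | IsFinOrbit T x}

/-- The first `n` entries of `x : ℕ → X` form an orbit in `O_n(T)`. -/
def IsOrbitSeg (T : X → Set X) (n : ℕ) (x : ℕ → X) : Prop :=
  ∀ i : ℕ, i + 1 < n → x (i + 1) ∈ T (x i)

/-- The shift on sequences. -/
def shiftSeq : (ℕ → X) → ℕ → X := fun x k => x (k + 1)

/-- The shift `σ` on the orbit space `O_ω(T)`. -/
def shiftOrb (T : X → Set X) : ↥(orbitSpace T) → ↥(orbitSpace T) :=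
  fun x => ⟨shiftSeq x.1, fun k => x.2 (k + 1)⟩

/-- The metric `d_ω` on sequences (`k`-th coordinate, `k ≥ 0`, has weight `2^{-(k+1)}`). -/
noncomputable def dOmega [MetricSpace X] (x y : ℕ → X) : ℝ :=
  ∑' k : ℕ, (1 / 2 : ℝ) ^ (k + 1) * (dist (x k) (y k) / (1 + dist (x k) (y k)))

/-- `T` is forward expansive with expansive constant `ε`. -/
def IsFwdExpansiveWith [MetricSpace X] (T : X → Set X) (ε : ℝ) : Prop :=
  0 < ε ∧ ∀ x ∈ orbitSpace T, ∀ y ∈ orbitSpace T, x ≠ y → ∃ n : ℕ, ε < dist (x n) (y n)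

/-- `T` is forward expansive. -/
def IsFwdExpansive [MetricSpace X] (T : X → Set X) : Prop :=
  ∃ ε : ℝ, IsFwdExpansiveWith T ε

/-- Extension by `0` of a potential `φ : O₂(T) → ℝ` to `X × X`. -/
noncomputable def ext2 (T : X → Set X) (φ : ↥(graph2 T) → ℝ) : X × X → ℝ :=
  fun p => if h : p ∈ graph2 T then φ ⟨p, h⟩ else 0

/-- The Birkhoff sum `S_n φ` along an element of `X^{n+1}` (equal to the sum
`∑_{i=1}^n φ(x_i, x_{i+1})` on orbits in `O_{n+1}(T)`). -/
noncomputable def birkhoff (T : X → Set X) (φ : ↥(graph2 T) → ℝ) {n : ℕ}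
    (x : Fin (n + 1) → X) : ℝ :=
  ∑ i : Fin n, ext2 T φ (x i.castSucc, x i.succ)

/-- `E` is `ε`-separated: distinct points of `E` are at distance `≥ ε`. -/
def eSep {Y : Type*} [PseudoMetricSpace Y] (ε : ℝ) (E : Set Y) : Prop :=
  ∀ x ∈ E, ∀ y ∈ E, x ≠ y → ε ≤ dist x y

/-- `∑_{x ∈ E} exp (S_n φ (x))` for a set `E` of orbit segments. -/
noncomputable def orbSum (T : X → Set X) (φ : ↥(graph2 T) → ℝ) (n : ℕ)
    (E : Set (Fin (n + 1) → X)) : ℝ≥0∞ :=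
  ∑' x : E, ENNReal.ofReal (Real.exp (birkhoff T φ (x : Fin (n + 1) → X)))

/-- Logarithm `ℝ≥0∞ → EReal`, with `log 0 = ⊥` and `log ⊤ = ⊤`. -/
noncomputable def elog (x : ℝ≥0∞) : EReal :=
  if x = 0 then ⊥ else if x = ⊤ then ⊤ else ((Real.log x.toReal : ℝ) : EReal)

/-- `sup_E ∑_{x ∈ E} exp (S_n φ (x))` over `ε`-separated subsets `E` of `O_{n+1}(T)`. -/
noncomputable def sepSup [MetricSpace X] (T : X → Set X) (φ : ↥(graph2 T) → ℝ)
    (n : ℕ) (ε : ℝ) : ℝ≥0∞ :=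
  ⨆ (E : Set (Fin (n + 1) → X)) (_ : E ⊆ finOrbits T n) (_ : eSep ε E), orbSum T φ n E

/-- `inf_F ∑_{x ∈ F} exp (S_n φ (x))` over `ε`-spanning subsets `F` of `O_{n+1}(T)`. -/
noncomputable def spanInf [MetricSpace X] (T : X → Set X) (φ : ↥(graph2 T) → ℝ)
    (n : ℕ) (ε : ℝ) : ℝ≥0∞ :=
  ⨅ (E : Set (Fin (n + 1) → X)) (_ : E ⊆ finOrbits T n)
    (_ : ∀ y ∈ finOrbits T n, ∃ x ∈ E, dist x y < ε), orbSum T φ n E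

/-- `limsup_n (1/n) log sup_E ∑_{x ∈ E} exp (S_n φ (x))` for a fixed `ε`. -/
noncomputable def pressSepEps [MetricSpace X] (T : X → Set X) (φ : ↥(graph2 T) → ℝ)
    (ε : ℝ) : EReal :=
  Filter.limsup (fun n : ℕ => (((n : ℝ)⁻¹ : ℝ) : EReal) * elog (sepSup T φ n ε)) atTop

/-- The spanning-set analogue of `pressSepEps`. -/
noncomputable def pressSpanEps [MetricSpace X] (T : X → Set X) (φ : ↥(graph2 T) → ℝ)
    (ε : ℝ) : EReal :=
  Filter.limsup (fun n : ℕ => (((n : ℝ)⁻¹ : ℝ) : EReal) * elog (spanInf T φ n ε)) atTop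

/-- The topological pressure `P(T,φ)` of a correspondence: the limit as `ε → 0⁺`
(equivalently, since `pressSepEps` is antitone in `ε`, the limsup) of
`limsup_n (1/n) log sup_E ∑_{x∈E} exp (S_nφ(x))` over `ε`-separated sets `E ⊆ O_{n+1}(T)`. -/
noncomputable def pressure [MetricSpace X] (T : X → Set X) (φ : ↥(graph2 T) → ℝ) : EReal :=
  Filter.limsup (fun ε : ℝ => pressSepEps T φ ε) (𝓝[>] (0 : ℝ))

section MeasureTheoryDefs

variable [MeasurableSpace X]

/-- A transition probability kernel on `X`: a measurable assignment of probability
measures. -/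
def IsTransKernel (Q : X → Measure X) : Prop :=
  Measurable Q ∧ ∀ x, IsProbabilityMeasure (Q x)

/-- The kernel `Q` is supported by the correspondence `T`. -/
def SupportedBy (T : X → Set X) (Q : X → Measure X) : Prop :=
  ∀ x, Q x (T x) = 1

/-- `markovLaw μ Q n = μQ^{[n]}`, the law on `X^{n+1}` of the first `n+1` states of the
Markov chain with initial law `μ` and transition kernel `Q`. -/
noncomputable def markovLaw (μ : Measure X) (Q : X → Measure X) :
    (n : ℕ) → Measure (Fin (n + 1) → X)
  | 0 => μ.map fun x => fun _ : Fin 1 => x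
  | n + 1 => (markovLaw μ Q n).bind fun x => (Q (x (Fin.last n))).map fun y => Fin.snoc x y

/-- `μQ^{[1]}` as a measure on `X × X`. -/
noncomputable def step2 (μ : Measure X) (Q : X → Measure X) : Measure (X × X) :=
  μ.bind fun x => (Q x).map fun y => (x, y)

/-- `ν` is the law `μQ^ω` on `X^ℕ` of the full trajectory of the Markov chain with
initial law `μ` and transition kernel `Q`. -/
def IsTrajLaw (μ : Measure X) (Q : X → Measure X) (ν : Measure (ℕ → X)) : Prop :=
  IsProbabilityMeasure ν ∧
    ∀ n : ℕ, ν.map (fun x (i : Fin (n + 1)) => x i.val) = markovLaw μ Q n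

end MeasureTheoryDefs

/-- The entropy `H_ν(𝒜)` of the finite measurable partition of `Y` given by the fibers
of `p : Y → I`. -/
noncomputable def partEntropy {Y : Type*} [MeasurableSpace Y] (ν : Measure Y)
    {I : Type*} [Fintype I] (p : Y → I) : ℝ :=
  ∑ i : I, Real.negMulLog ((ν (p ⁻¹' {i})).toReal)

/-- The measure-theoretic entropy `h_μ(Q)` of a transition probability kernel:
`sup_𝒜 lim_n (1/n) H_{μQ^{[n-1]}}(𝒜ⁿ)` over finite measurable partitions `𝒜` of `X`. -/
noncomputable def kernelEntropy [MeasurableSpace X] (μ : Measure X) (Q : X → Measure X) :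
    EReal :=
  ⨆ (m : ℕ) (p : X → Fin m) (_ : Measurable p),
    ((Filter.limsup
        (fun n : ℕ => (n : ℝ)⁻¹ * partEntropy (markovLaw μ Q (n - 1)) fun x => p ∘ x)
        atTop : ℝ) : EReal)

/-- The Kolmogorov–Sinai entropy `h_ν(g)` of a measurable map `g`:
`sup_𝒫 lim_n (1/n) H_ν(⋁_{i<n} g^{-i}𝒫)` over finite measurable partitions `𝒫`. -/
noncomputable def ksEntropy {Y : Type*} [MeasurableSpace Y] (ν : Measure Y) (g : Y → Y) :
    EReal :=
  ⨆ (m : ℕ) (p : Y → Fin m) (_ : Measurable p),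
    ((Filter.limsup
        (fun n : ℕ => (n : ℝ)⁻¹ * partEntropy ν fun y => fun i : Fin n => p (g^[i.val] y))
        atTop : ℝ) : EReal)

/-- The energy term `∫_X ∫_{T(x)} φ(x,y) dQ_x(y) dμ(x)`. -/
noncomputable def energyInt [MeasurableSpace X] (T : X → Set X) (φ : ↥(graph2 T) → ℝ)
    (Q : X → Measure X) (μ : Measure X) : ℝ :=
  ∫ x, (∫ y in T x, ext2 T φ (x, y) ∂(Q x)) ∂μ

/-- `sup_{Q,μ} { h_μ(Q) + ∫∫ φ dQ dμ }` over transition probability kernels `Q`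
supported by `T` and `Q`-invariant Borel probability measures `μ`. -/
noncomputable def varSup [MetricSpace X] [MeasurableSpace X] (T : X → Set X)
    (φ : ↥(graph2 T) → ℝ) : EReal :=
  ⨆ (Q : X → Measure X) (_ : IsTransKernel Q) (_ : SupportedBy T Q) (μ : Measure X)
    (_ : IsProbabilityMeasure μ) (_ : μ.bind Q = μ),
    kernelEntropy μ Q + ((energyInt T φ Q μ : ℝ) : EReal)

/-- `(μ, Q)` is an equilibrium state for `T` and `φ`. -/
def IsEquilibrium [MetricSpace X] [MeasurableSpace X] (T : X → Set X) (φ : ↥(graph2 T) → ℝ)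
    (μ : Measure X) (Q : X → Measure X) : Prop :=
  IsTransKernel Q ∧ SupportedBy T Q ∧ IsProbabilityMeasure μ ∧ μ.bind Q = μ ∧
    pressure T φ = kernelEntropy μ Q + ((energyInt T φ Q μ : ℝ) : EReal)

/-- `H(ρ) = -∑_y ρ{y} log ρ{y}` if `ρ` is supported on a countable set, `∞` otherwise. -/
noncomputable def atomEntropy {Y : Type*} [MeasurableSpace Y] (ρ : Measure Y) : ℝ≥0∞ :=
  if ∃ A : Set Y, A.Countable ∧ MeasurableSet A ∧ ρ A = 1 then
    ∑' y : Y, ENNReal.ofReal (Real.negMulLog ((ρ {y}).toReal))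
  else ⊤

/-- `R` is a backward conditional transition probability kernel of `ν` from `X₂` to `X₁`
supported on `M`. -/
def IsBackwardCondKernel {X₁ X₂ : Type*} [MeasurableSpace X₁] [MeasurableSpace X₂]
    (ν : Measure (X₁ × X₂)) (M : Set (X₁ × X₂)) (R : X₂ → Measure X₁) : Prop :=
  Measurable R ∧ (∀ x, IsProbabilityMeasure (R x)) ∧
    (∀ x₂ ∈ Prod.snd '' M, R x₂ {x₁ | (x₁, x₂) ∈ M} = 1) ∧
    ∀ C : Set (X₁ × X₂), MeasurableSet C →
      ν C = ∫⁻ x₂, R x₂ {x₁ | (x₁, x₂) ∈ C} ∂(ν.map Prod.snd)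

/-- `m(k) = ∑_{l<k} (m_l + p_l)`, the offsets in the specification property. -/
def specShift {n : ℕ} (m p : Fin n → ℕ) (k : ℕ) : ℕ :=
  ∑ l : Fin n, if l.val < k then m l + p l else 0

/-- The specification property for correspondences. -/
def HasSpecification [MetricSpace X] (T : X → Set X) : Prop :=
  ∀ ε : ℝ, 0 < ε → ∃ M : ℕ, ∀ (n : ℕ) (m p : Fin n → ℕ) (x : Fin n → ℕ → X),
    (∀ j, 1 ≤ m j) → (∀ j, M < p j) → (∀ j, IsOrbitSeg T (m j) (x j)) →
    ∃ z ∈ orbitSpace T, ∀ j : Fin n, ∀ i < m j,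
      dist (z (specShift m p j.val + i)) (x j i) < ε

/-- `φ` is Bowen summable w.r.t. the expansive constant `ε`, i.e.
`sup_n K_{φ,T}(ε,n) < ∞`. -/
def BowenSummableWith [MetricSpace X] (T : X → Set X) (φ : ↥(graph2 T) → ℝ) (ε : ℝ) : Prop :=
  ∃ C : ℝ, ∀ (n : ℕ) (x y : Fin (n + 1) → X), IsFinOrbit T x → IsFinOrbit T y →
    (∀ k, dist (x k) (y k) < ε) → |birkhoff T φ x - birkhoff T φ y| ≤ C

/-- Forward image `T(A) = ⋃_{x ∈ A} T(x)`. -/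
def corrImage (T : X → Set X) (A : Set X) : Set X := ⋃ x ∈ A, T x

/-- Iterated forward images `Tⁿ(A)`. -/
def corrIter (T : X → Set X) : ℕ → Set X → Set X
  | 0, A => A
  | n + 1, A => corrImage T (corrIter T n A)

/-- Backward image `T^{-1}(A) = {y : A ∩ T(y) ≠ ∅}`. -/
def corrPre (T : X → Set X) (A : Set X) : Set X := {y | (A ∩ T y).Nonempty}

/-- Iterated backward images `T^{-n}(A)`. -/
def corrPreIter (T : X → Set X) : ℕ → Set X → Set X
  | 0, A => A
  | n + 1, A => corrPre T (corrPreIter T n A)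

/-- `T` is an open correspondence. -/
def IsOpenCorr [MetricSpace X] (T : X → Set X) : Prop :=
  ∀ U : Set X, IsOpen U → IsOpen (corrImage T U)

/-- `T` is strongly transitive: `⋃_{n ≥ 1} T^{-n}(x)` is dense for every `x`. -/
def StronglyTransitive [MetricSpace X] (T : X → Set X) : Prop :=
  ∀ x : X, Dense (⋃ n : ℕ, corrPreIter T (n + 1) {x})

/-- `T` is distance-expanding. -/
def DistanceExpanding [MetricSpace X] (T : X → Set X) : Prop :=
  ∃ lam : ℝ, 1 < lam ∧ ∃ η : ℝ, 0 < η ∧ ∃ n : ℕ, 1 ≤ n ∧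
    ∀ x y : X, dist x y ≤ η →
      ∀ x' ∈ corrIter T n {x}, ∀ y' ∈ corrIter T n {y}, lam * dist x y ≤ dist x' y'

/-- `T` is topologically exact. -/
def TopologicallyExact [MetricSpace X] (T : X → Set X) : Prop :=
  ∀ U : Set X, IsOpen U → U.Nonempty → ∃ N : ℕ, 1 ≤ N ∧ corrIter T N U = Set.univ

/-- `φ : O₂(T) → ℝ` is Hölder continuous w.r.t. the metric
`d₂((x₁,x₂),(y₁,y₂)) = max (d x₁ y₁) (d x₂ y₂)` (the product metric on `X × X`). -/
def HolderOn [MetricSpace X] (T : X → Set X) (φ : ↥(graph2 T) → ℝ) : Prop :=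
  ∃ C : ℝ, 0 < C ∧ ∃ α : ℝ, 0 < α ∧ α ≤ 1 ∧
    ∀ a b : ↥(graph2 T), |φ a - φ b| ≤ C * dist (a : X × X) (b : X × X) ^ α

/-- `O_{-n}(x)`: backward orbits of length `n+1` terminating at `x`. -/
def backOrbits (T : X → Set X) (n : ℕ) (x : X) : Set (Fin (n + 1) → X) :=
  {y | IsFinOrbit T y ∧ y (Fin.last n) = x}

/-- The lift `φ̃(x₁,x₂,…) = φ(x₁,x₂)` of a potential to the orbit space. -/
def liftPhi (T : X → Set X) (φ : ↥(graph2 T) → ℝ) : ↥(orbitSpace T) → ℝ :=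
  fun x => φ ⟨(x.1 0, x.1 1), x.2 0⟩

/-- The Ruelle operator `L_{φ̃}` for the shift on the orbit space:
`(L_{φ̃} Φ)(x) = ∑_{σ(y)=x} Φ(y) exp(φ̃(y))`. -/
noncomputable def ruelleL (T : X → Set X) (φ : ↥(graph2 T) → ℝ)
    (Φ : ↥(orbitSpace T) → ℝ) : ↥(orbitSpace T) → ℝ :=
  fun x => ∑ᶠ (y : ↥(orbitSpace T)) (_ : shiftOrb T y = x), Φ y * Real.exp (liftPhi T φ y)

/-- Classical topological pressure of a map `g : Y → Y` w.r.t. a potential `ψ` and an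
explicit distance function `ρ`, via `(n,ε)`-separated sets. -/
noncomputable def dynPressure {Y : Type*} (ρ : Y → Y → ℝ) (g : Y → Y) (ψ : Y → ℝ) : EReal :=
  Filter.limsup (fun ε : ℝ =>
    Filter.limsup (fun n : ℕ => (((n : ℝ)⁻¹ : ℝ) : EReal) * elog
      (⨆ (E : Set Y) (_ : ∀ x ∈ E, ∀ y ∈ E, x ≠ y → ∃ j < n, ε ≤ ρ (g^[j] x) (g^[j] y)),
        ∑' x : E, ENNReal.ofReal (Real.exp (∑ j ∈ Finset.range n, ψ (g^[j] (x : Y))))))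
      atTop) (𝓝[>] (0 : ℝ))

end Corr
namespace Corr

/-! ### Positive operators with bounded distortion -/

/-- A positive operator on functions with bounded distortion under iteration and a uniform
irreducibility property; the Ruelle operators below are of this kind. -/
structure IsTransferOp {X : Type*} [MetricSpace X] (L : Module.End ℝ (X → ℝ)) : Prop where
  nonneg : ∀ F : X → ℝ, 0 ≤ F → 0 ≤ L F
  one_pos : ∃ m : ℝ, 0 < m ∧ ∀ x, m ≤ L 1 x
  distortion : ∀ F : X → ℝ, Continuous F → 0 ≤ F → ∀ ε > 0, ∃ δ > 0, ∀ x x', dist x x' < δ →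
    ∀ n : ℕ, (L ^ n) F x ≤ Real.exp ε * ((L ^ n) F x' + ε * (L ^ n) 1 x')
  irreducible : ∀ δ > 0, ∃ K : ℕ, ∃ c > 0, ∀ x z, ∃ k, k ≤ K ∧ ∃ w, dist w z < δ ∧
    ∀ F : X → ℝ, 0 ≤ F → c * F w ≤ (L ^ k) F x

theorem end_pow_succ_apply {X : Type*} (L : Module.End ℝ (X → ℝ)) (n : ℕ) (F : X → ℝ) :
    (L ^ (n + 1)) F = L ((L ^ n) F) := by
  rw [pow_succ', Module.End.mul_apply]

theorem end_pow_add_apply {X : Type*} (L : Module.End ℝ (X → ℝ)) (n k : ℕ) (F : X → ℝ) :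
    (L ^ (n + k)) F = (L ^ n) ((L ^ k) F) := by
  rw [pow_add, Module.End.mul_apply]

section PositiveOperator

variable {X : Type*} {L : Module.End ℝ (X → ℝ)}

theorem pow_apply_nonneg (hL : ∀ F : X → ℝ, 0 ≤ F → 0 ≤ L F) (n : ℕ) {F : X → ℝ} (hF : 0 ≤ F) :
    0 ≤ (L ^ n) F := by
  induction n with
  | zero => simpa using hF
  | succ n ih => rw [end_pow_succ_apply]; exact hL _ ih

theorem pow_apply_mono (hL : ∀ F : X → ℝ, 0 ≤ F → 0 ≤ L F) (n : ℕ) {F G : X → ℝ} (h : F ≤ G) :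
    (L ^ n) F ≤ (L ^ n) G := by
  have := pow_apply_nonneg hL n (sub_nonneg.2 h)
  rwa [map_sub, sub_nonneg] at this

theorem apply_mono (hL : ∀ F : X → ℝ, 0 ≤ F → 0 ≤ L F) {F G : X → ℝ} (h : F ≤ G) :
    L F ≤ L G := by
  simpa using pow_apply_mono hL 1 h

theorem abs_pow_apply_le (hL : ∀ F : X → ℝ, 0 ≤ F → 0 ≤ L F) (n : ℕ) {F G : X → ℝ}
    (h : ∀ x, |F x| ≤ G x) (x : X) : |(L ^ n) F x| ≤ (L ^ n) G x := by
  rw [abs_le]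
  constructor
  · have := pow_apply_mono hL n (F := -G) (G := F) (fun x => neg_le_of_abs_le (h x)) x
    simpa using this
  · exact pow_apply_mono hL n (fun x => le_of_abs_le (h x)) x

theorem pow_apply_le_geometric (hL : ∀ F : X → ℝ, 0 ≤ F → 0 ≤ L F) {B : ℝ} {H : X → ℝ}
    (hB : 0 ≤ B) (hH : ∀ x, L H x ≤ B * H x) (n : ℕ) (x : X) : (L ^ n) H x ≤ B ^ n * H x := by
  induction n generalizing x with
  | zero => simp
  | succ n ih =>
    rw [end_pow_succ_apply]
    calc L ((L ^ n) H) x ≤ L (B ^ n • H) x := apply_mono hL (fun y => ih y) x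
      _ = B ^ n * L H x := by simp
      _ ≤ B ^ n * (B * H x) := by gcongr; exact hH x
      _ = _ := by ring

theorem pow_one_le_geometric (hL : ∀ F : X → ℝ, 0 ≤ F → 0 ≤ L F) {B : ℝ}
    (hB : 0 ≤ B) (hH : ∀ x, L 1 x ≤ B) (n : ℕ) (x : X) : (L ^ n) 1 x ≤ B ^ n := by
  simpa using pow_apply_le_geometric hL hB (H := 1) (by simpa using hH) n x

theorem geometric_le_pow_one (hL : ∀ F : X → ℝ, 0 ≤ F → 0 ≤ L F) {m : ℝ}
    (hm : 0 ≤ m) (h : ∀ x, m ≤ L 1 x) (n : ℕ) (x : X) : m ^ n ≤ (L ^ n) 1 x := by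
  induction n generalizing x with
  | zero => simp
  | succ n ih =>
    rw [end_pow_succ_apply]
    calc m ^ (n + 1) = m ^ n * m := by ring
      _ ≤ m ^ n * L 1 x := by gcongr; exact h x
      _ = L (m ^ n • (1 : X → ℝ)) x := by simp
      _ ≤ L ((L ^ n) 1) x := apply_mono hL (fun y => by simpa using ih y) x

end PositiveOperator

namespace IsTransferOp

variable {X : Type*} [MetricSpace X] {L : Module.End ℝ (X → ℝ)}

theorem pow_one_pos (hL : IsTransferOp L) (n : ℕ) (x : X) : 0 < (L ^ n) 1 x := by
  obtain ⟨m, hm, h⟩ := hL.one_pos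
  exact (pow_pos hm n).trans_le (geometric_le_pow_one hL.nonneg hm.le h n x)

theorem equicontinuous [CompactSpace X] (hL : IsTransferOp L) {F : X → ℝ} (hF : Continuous F)
    {ε : ℝ} (hε : 0 < ε) : ∃ δ > 0, ∀ x x', dist x x' < δ →
      ∀ n : ℕ, |(L ^ n) F x - (L ^ n) F x'| ≤ ε * (L ^ n) 1 x' := by
  have key : ∀ F : X → ℝ, Continuous F → 0 ≤ F → ∀ ε > 0, ∃ δ > 0, ∀ x x', dist x x' < δ →
      ∀ n : ℕ, |(L ^ n) F x - (L ^ n) F x'| ≤ ε * (L ^ n) 1 x' := by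
    intro F hF hF0 ε hε
    obtain ⟨K, hK⟩ : ∃ K, ∀ x, F x ≤ K := by
      obtain ⟨K, hK⟩ := (isCompact_range hF).bddAbove
      exact ⟨K, fun x => hK ⟨x, rfl⟩⟩
    have hlim : Tendsto (fun s : ℝ => ((Real.exp s - 1) * K + Real.exp s * s) *
        (Real.exp s * (1 + s))) (𝓝[>] 0) (𝓝 0) := by
      have : Continuous (fun s : ℝ => ((Real.exp s - 1) * K + Real.exp s * s) *
        (Real.exp s * (1 + s))) := by fun_prop
      simpa using (this.tendsto 0).mono_left nhdsWithin_le_nhds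
    have hlim' : Tendsto (fun s : ℝ => ((Real.exp s - 1) * K + Real.exp s * s))
        (𝓝[>] 0) (𝓝 0) := by
      have : Continuous (fun s : ℝ => ((Real.exp s - 1) * K + Real.exp s * s)) := by fun_prop
      simpa using (this.tendsto 0).mono_left nhdsWithin_le_nhds
    obtain ⟨s, ⟨hs1, hs2⟩, hs0⟩ := ((hlim.eventually_lt_const hε).and
      (hlim'.eventually_lt_const hε)).and self_mem_nhdsWithin |>.exists
    have hs0 : 0 < s := hs0
    obtain ⟨δ₁, hδ₁, h₁⟩ := hL.distortion F hF hF0 s hs0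
    obtain ⟨δ₂, hδ₂, h₂⟩ := hL.distortion 1 continuous_const zero_le_one s hs0
    have one : ∀ x x', dist x x' < δ₁ → ∀ n : ℕ, (L ^ n) F x - (L ^ n) F x' ≤
        ((Real.exp s - 1) * K + Real.exp s * s) * (L ^ n) 1 x' := by
      intro x x' hd n
      have h := h₁ x x' hd n
      have hb : (L ^ n) F x' ≤ K * (L ^ n) 1 x' := by
        have := pow_apply_mono hL.nonneg n (F := F) (G := K • 1) (fun y => by simpa using hK y) x'
        simpa using this
      have := mul_le_mul_of_nonneg_left hb (sub_nonneg.2 (Real.one_le_exp hs0.le))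
      nlinarith
    refine ⟨min δ₁ δ₂, lt_min hδ₁ hδ₂, fun x x' hd n => ?_⟩
    have hd1 := hd.trans_le (min_le_left _ _)
    have hd2 := hd.trans_le (min_le_right _ _)
    have p := (hL.pow_one_pos n x')
    have p' := (hL.pow_one_pos n x)
    rw [abs_le]
    constructor
    · have a := one x' x (by rwa [dist_comm]) n
      have b := h₂ x x' hd2 n
      have hK0 : 0 ≤ K := (hF0 x).trans (hK x)
      have c0 : 0 ≤ (Real.exp s - 1) * K + Real.exp s * s := by
        have := Real.one_le_exp hs0.le
        have := sub_nonneg.2 this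
        positivity
      have : ((Real.exp s - 1) * K + Real.exp s * s) * (L ^ n) 1 x ≤ ε * (L ^ n) 1 x' := by
        calc _ ≤ ((Real.exp s - 1) * K + Real.exp s * s) *
              (Real.exp s * ((L ^ n) 1 x' + s * (L ^ n) 1 x')) := by gcongr
          _ = (((Real.exp s - 1) * K + Real.exp s * s) * (Real.exp s * (1 + s))) *
              (L ^ n) 1 x' := by ring
          _ ≤ _ := by gcongr
      linarith
    · exact (one x x' hd1 n).trans (by gcongr)
  obtain ⟨K, hK⟩ : ∃ K, ∀ x, |F x| ≤ K := by
    obtain ⟨K, hK⟩ := (isCompact_range hF.abs).bddAbove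
    exact ⟨K, fun x => hK ⟨x, rfl⟩⟩
  have hK' : ∀ x, |F x| ≤ |K| := fun x => (hK x).trans (le_abs_self _)
  have hpos : 0 < |K| + 1 := by positivity
  obtain ⟨δ₁, hδ₁, h₁⟩ := key (F + |K| • 1) (by fun_prop)
    (fun x => by have := neg_le_of_abs_le (hK' x); simp; linarith) (ε / 2) (by positivity)
  obtain ⟨δ₂, hδ₂, h₂⟩ := key 1 continuous_const zero_le_one (ε / 2 / (|K| + 1)) (by positivity)
  refine ⟨min δ₁ δ₂, lt_min hδ₁ hδ₂, fun x x' hd n => ?_⟩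
  have a := h₁ x x' (hd.trans_le (min_le_left _ _)) n
  have b := h₂ x x' (hd.trans_le (min_le_right _ _)) n
  have p := (hL.pow_one_pos n x')
  have b' : |K| * |(L ^ n) 1 x - (L ^ n) 1 x'| ≤ ε / 2 * (L ^ n) 1 x' := by
    calc _ ≤ (|K| + 1) * (ε / 2 / (|K| + 1) * (L ^ n) 1 x') := by gcongr; linarith
      _ = _ := by field_simp
  rw [map_add, map_smul] at a
  simp only [Pi.add_apply, Pi.smul_apply, smul_eq_mul] at a
  have e : (L ^ n) F x - (L ^ n) F x' = ((L ^ n) F x + |K| * (L ^ n) 1 x -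
      ((L ^ n) F x' + |K| * (L ^ n) 1 x')) - |K| * ((L ^ n) 1 x - (L ^ n) 1 x') := by ring
  rw [e]
  refine (abs_sub _ _).trans ?_
  rw [abs_mul, abs_abs]
  linarith

theorem continuous_pow [CompactSpace X] (hL : IsTransferOp L) {F : X → ℝ} (hF : Continuous F)
    (n : ℕ) : Continuous ((L ^ n) F) := by
  rw [Metric.continuous_iff]
  intro x' ε hε
  have p := hL.pow_one_pos n x'
  obtain ⟨δ, hδ, h⟩ := hL.equicontinuous hF (ε := ε / 2 / (L ^ n) 1 x') (by positivity)
  refine ⟨δ, hδ, fun x hx => ?_⟩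
  have := h x x' hx n
  rw [div_mul_cancel₀ _ p.ne'] at this
  rw [Real.dist_eq]
  linarith

theorem continuous_apply [CompactSpace X] (hL : IsTransferOp L) {F : X → ℝ} (hF : Continuous F) :
    Continuous (L F) := by
  simpa using hL.continuous_pow hF 1

theorem exists_one_le_bound [CompactSpace X] (hL : IsTransferOp L) :
    ∃ C : ℝ, 1 ≤ C ∧ ∀ x, L 1 x ≤ C := by
  obtain ⟨K, hK⟩ := (isCompact_range (hL.continuous_apply (F := 1) continuous_const)).bddAbove
  exact ⟨max K 1, le_max_right _ _, fun x => (hK ⟨x, rfl⟩).trans (le_max_left _ _)⟩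

theorem exists_ratio_bound [CompactSpace X] (hL : IsTransferOp L) :
    ∃ c : ℝ, 0 < c ∧ ∀ (n : ℕ) (x z : X), c * (L ^ n) 1 z ≤ (L ^ n) 1 x := by
  obtain ⟨δ, hδ, h⟩ := hL.equicontinuous (F := 1) continuous_const (ε := 1 / 2) (by norm_num)
  obtain ⟨K, c, hc, hK⟩ := hL.irreducible δ hδ
  obtain ⟨C, hC1, hC⟩ := hL.exists_one_le_bound
  obtain ⟨m, hm, hm1⟩ := hL.one_pos
  have hC0 : 0 < C := by linarith
  have hm' : 0 < min m 1 := lt_min hm zero_lt_one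
  have up : ∀ (n : ℕ) x, n ≤ K → (L ^ n) 1 x ≤ C ^ K := fun n x hn =>
    (pow_one_le_geometric hL.nonneg hC0.le hC n x).trans (pow_le_pow_right₀ hC1 hn)
  refine ⟨min (c / 2 / C ^ K) ((min m 1) ^ K / C ^ K), by positivity, fun n x z => ?_⟩
  obtain ⟨k, hk, w, hw, hF⟩ := hK x z
  have pz := hL.pow_one_pos n z
  rcases le_or_gt k n with hkn | hkn
  · obtain ⟨l, rfl⟩ := Nat.exists_eq_add_of_le hkn
    have a := hF ((L ^ l) 1) (pow_apply_nonneg hL.nonneg l zero_le_one)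
    rw [← end_pow_add_apply] at a
    have b := neg_le_of_abs_le (h w z hw l)
    have d : (L ^ (k + l)) 1 z ≤ C ^ K * (L ^ l) 1 z := by
      rw [add_comm, end_pow_add_apply]
      have := pow_apply_mono hL.nonneg l (F := (L ^ k) 1) (G := C ^ K • 1)
        (fun y => by simpa using up k y hk) z
      simpa using this
    calc _ ≤ c / 2 / C ^ K * (L ^ (k + l)) 1 z := by gcongr; exact min_le_left _ _
      _ ≤ c / 2 / C ^ K * (C ^ K * (L ^ l) 1 z) := by gcongr
      _ = c * ((L ^ l) 1 z / 2) := by field_simp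
      _ ≤ c * (L ^ l) 1 w := by gcongr; linarith
      _ ≤ _ := a
  · calc _ ≤ (min m 1) ^ K / C ^ K * (L ^ n) 1 z := by gcongr; exact min_le_right _ _
      _ ≤ (min m 1) ^ K / C ^ K * C ^ K := by gcongr; exact up n z (by omega)
      _ = (min m 1) ^ K := by field_simp
      _ ≤ (min m 1) ^ n := pow_le_pow_of_le_one hm'.le (min_le_right _ _) (by omega)
      _ ≤ _ := geometric_le_pow_one hL.nonneg hm'.le
        (fun y => (min_le_left _ _).trans (hm1 y)) n x

theorem exists_growth_rate [CompactSpace X] [Nonempty X] (hL : IsTransferOp L) :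
    ∃ Λ : ℝ, 0 < Λ ∧ ∃ c : ℝ, 0 < c ∧ ∀ (n : ℕ) (x : X),
      c * Λ ^ n ≤ (L ^ n) 1 x ∧ c * (L ^ n) 1 x ≤ Λ ^ n := by
  obtain ⟨c, hc, hr⟩ := hL.exists_ratio_bound
  obtain ⟨C, hC1, hC⟩ := hL.exists_one_le_bound
  obtain ⟨m, hm, hm1⟩ := hL.one_pos
  have hC0 : 0 < C := by linarith
  obtain ⟨x₀⟩ := ‹Nonempty X›
  set a : ℕ → ℝ := fun n => (L ^ n) 1 x₀ with ha
  have ap : ∀ n, 0 < a n := fun n => hL.pow_one_pos n x₀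
  have up : ∀ n k, c * a (n + k) ≤ a n * a k := by
    intro n k
    have := pow_apply_mono hL.nonneg n (F := c • (L ^ k) 1) (G := a k • 1)
      (fun y => by simpa using hr k x₀ y) x₀
    simp only [map_smul, ← end_pow_add_apply] at this
    simpa [mul_comm] using this
  have lo : ∀ n k, c * (a n * a k) ≤ a (n + k) := by
    intro n k
    have := pow_apply_mono hL.nonneg n (F := (c * a k) • 1) (G := (L ^ k) 1)
      (fun y => by simpa using hr k y x₀) x₀
    simp only [map_smul, ← end_pow_add_apply] at this
    refine le_trans (le_of_eq ?_) this
    simp [ha]; ring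
  set u : ℕ → ℝ := fun n => Real.log (a n) - Real.log c
  set v : ℕ → ℝ := fun n => -Real.log (a n) - Real.log c
  have hu : Subadditive u := by
    intro n k
    have := Real.log_le_log (by have := ap (n + k); positivity) (up n k)
    rw [Real.log_mul hc.ne' (ap _).ne', Real.log_mul (ap _).ne' (ap _).ne'] at this
    simp only [u]; linarith
  have hv : Subadditive v := by
    intro n k
    have := Real.log_le_log (by have := ap n; have := ap k; positivity) (lo n k)
    rw [Real.log_mul hc.ne' (mul_pos (ap _) (ap _)).ne',
      Real.log_mul (ap _).ne' (ap _).ne'] at this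
    simp only [v]; linarith
  have bnd : ∀ n : ℕ, n * Real.log m ≤ Real.log (a n) ∧ Real.log (a n) ≤ n * Real.log C := by
    intro n
    constructor
    · rw [← Real.log_pow]
      exact Real.log_le_log (by positivity) (geometric_le_pow_one hL.nonneg hm.le hm1 n x₀)
    · rw [← Real.log_pow]
      exact Real.log_le_log (ap n) (pow_one_le_geometric hL.nonneg hC0.le hC n x₀)
  have hlogc : ∀ n : ℕ, n ≠ 0 → -|Real.log c| ≤ -Real.log c / n := by
    intro n hn
    have h1 : (1 : ℝ) ≤ n := by exact_mod_cast Nat.one_le_iff_ne_zero.2 hn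
    rw [le_div_iff₀ (by linarith)]
    have := neg_abs_le (Real.log c)
    have := le_abs_self (Real.log c)
    have := abs_nonneg (Real.log c)
    nlinarith
  have hub : BddBelow (range fun n => u n / n) := by
    refine ⟨min 0 (Real.log m - |Real.log c|), ?_⟩
    rintro _ ⟨n, rfl⟩
    rcases Nat.eq_zero_or_pos n with rfl | hn
    · simp
    · have := hlogc n hn.ne'
      have hn' : (0 : ℝ) < n := by exact_mod_cast hn
      have h2 : Real.log m ≤ Real.log (a n) / n := by
        rw [le_div_iff₀ hn']; linarith [(bnd n).1]
      refine (min_le_right _ _).trans ?_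
      simp only [u, sub_div]
      rw [neg_div] at this
      linarith
  have hvb : BddBelow (range fun n => v n / n) := by
    refine ⟨min 0 (-Real.log C - |Real.log c|), ?_⟩
    rintro _ ⟨n, rfl⟩
    rcases Nat.eq_zero_or_pos n with rfl | hn
    · simp
    · have := hlogc n hn.ne'
      have hn' : (0 : ℝ) < n := by exact_mod_cast hn
      have h2 : Real.log (a n) / n ≤ Real.log C := by
        rw [div_le_iff₀ hn']; linarith [(bnd n).2]
      refine (min_le_right _ _).trans ?_
      simp only [v, sub_div, neg_div]
      rw [neg_div] at this
      linarith
  have hsum : hu.lim + hv.lim = 0 := by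
    have h1 := (hu.tendsto_lim hub).add (hv.tendsto_lim hvb)
    have h2 : Tendsto (fun n : ℕ => (-2 * Real.log c) / (n : ℝ)) atTop (𝓝 0) :=
      tendsto_const_div_atTop_nhds_zero_nat _
    refine tendsto_nhds_unique (h1.congr fun n => ?_) h2
    simp only [u, v]
    ring
  have hΛu : ∀ n : ℕ, n * hu.lim ≤ u n := by
    intro n
    rcases Nat.eq_zero_or_pos n with rfl | hn
    · have := hu 0 0
      simp only [add_zero] at this
      simp; linarith
    · have := hu.lim_le_div hub hn.ne'
      rwa [le_div_iff₀ (by exact_mod_cast hn), mul_comm] at this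
  have hΛv : ∀ n : ℕ, n * hv.lim ≤ v n := by
    intro n
    rcases Nat.eq_zero_or_pos n with rfl | hn
    · have := hv 0 0
      simp only [add_zero] at this
      simp; linarith
    · have := hv.lim_le_div hvb hn.ne'
      rwa [le_div_iff₀ (by exact_mod_cast hn), mul_comm] at this
  have A : ∀ n : ℕ, c * Real.exp hu.lim ^ n ≤ a n := by
    intro n
    have := hΛu n
    rw [← Real.exp_nat_mul, ← Real.exp_log hc, ← Real.exp_log (ap n), ← Real.exp_add,
      Real.exp_le_exp]
    simp only [u] at this; linarith
  have B : ∀ n : ℕ, c * a n ≤ Real.exp hu.lim ^ n := by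
    intro n
    have := hΛv n
    rw [← Real.exp_nat_mul, ← Real.exp_log hc, ← Real.exp_log (ap n), ← Real.exp_add,
      Real.exp_le_exp]
    have e : hv.lim = - hu.lim := by linarith
    rw [e] at this
    simp only [v] at this; linarith
  refine ⟨Real.exp hu.lim, Real.exp_pos _, c * c, by positivity, fun n x => ⟨?_, ?_⟩⟩
  · calc c * c * Real.exp hu.lim ^ n = c * (c * Real.exp hu.lim ^ n) := by ring
      _ ≤ c * a n := by gcongr; exact A n
      _ ≤ _ := hr n x x₀
  · calc c * c * (L ^ n) 1 x = c * (c * (L ^ n) 1 x) := by ring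
      _ ≤ c * a n := by gcongr; exact hr n x₀ x
      _ ≤ _ := B n

end IsTransferOp

theorem exists_abs_bound {X : Type*} [TopologicalSpace X] [CompactSpace X] {f : X → ℝ}
    (hf : Continuous f) : ∃ b : ℝ, 0 ≤ b ∧ ∀ x, |f x| ≤ b := by
  obtain ⟨K, hK⟩ := (isCompact_range hf.abs).bddAbove
  exact ⟨|K|, abs_nonneg _, fun x => (hK ⟨x, rfl⟩).trans (le_abs_self _)⟩

theorem exists_pos_lower_bound {X : Type*} [TopologicalSpace X] [CompactSpace X] {f : X → ℝ}
    (hf : Continuous f) (hpos : ∀ x, 0 < f x) : ∃ a : ℝ, 0 < a ∧ ∀ x, a ≤ f x := by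
  rcases isEmpty_or_nonempty X with h | h
  · exact ⟨1, one_pos, fun x => h.elim x⟩
  · obtain ⟨x, -, hx⟩ := isCompact_univ.exists_isMinOn univ_nonempty hf.continuousOn
    exact ⟨f x, hpos x, fun y => hx (mem_univ y)⟩

/-- Arzelà–Ascoli for sequences of real functions on a compact metric space. -/
theorem exists_subseq_uniform_limit {X : Type*} [MetricSpace X] [CompactSpace X]
    (u : ℕ → X → ℝ) (K : ℝ) (hK : ∀ n x, |u n x| ≤ K)
    (heq : ∀ ε > 0, ∃ δ > 0, ∀ x x', dist x x' < δ → ∀ n, |u n x - u n x'| ≤ ε) :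
    ∃ g : X → ℝ, Continuous g ∧ ∃ s : ℕ → ℕ, StrictMono s ∧
      ∀ ε > 0, ∀ᶠ j in atTop, ∀ x, |u (s j) x - g x| ≤ ε := by
  have hc : ∀ n, Continuous (u n) := by
    intro n
    rw [Metric.continuous_iff]
    intro x' ε hε
    obtain ⟨δ, hδ, h⟩ := heq (ε / 2) (by positivity)
    refine ⟨δ, hδ, fun x hx => ?_⟩
    have := h x x' hx n
    rw [Real.dist_eq]
    linarith
  let U : ℕ → BoundedContinuousFunction X ℝ := fun n =>
    BoundedContinuousFunction.mkOfCompact ⟨u n, hc n⟩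
  have hcomp : IsCompact (closure (range U)) := by
    refine BoundedContinuousFunction.arzela_ascoli (Icc (-K) K) isCompact_Icc (range U) ?_ ?_
    · rintro _ x ⟨n, rfl⟩
      exact abs_le.1 (hK n x)
    · intro x₀
      rw [Metric.equicontinuousAt_iff]
      intro ε hε
      obtain ⟨δ, hδ, h⟩ := heq (ε / 2) (by positivity)
      refine ⟨δ, hδ, fun x hx i => ?_⟩
      obtain ⟨_, n, rfl⟩ := i
      have := h x₀ x (by rwa [dist_comm]) n
      change dist (u n x₀) (u n x) < ε
      rw [Real.dist_eq]
      linarith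
  obtain ⟨g, -, s, hs, hlim⟩ := hcomp.tendsto_subseq (fun n => subset_closure (mem_range_self n))
  refine ⟨g, g.continuous, s, hs, fun ε hε => ?_⟩
  filter_upwards [(Metric.tendsto_nhds.1 hlim) ε hε] with j hj x
  have := (BoundedContinuousFunction.dist_coe_le_dist (f := U (s j)) (g := g) x).trans hj.le
  rwa [Real.dist_eq] at this

namespace IsTransferOp

variable {X : Type*} [MetricSpace X] {L : Module.End ℝ (X → ℝ)}

theorem smul (hL : IsTransferOp L) {a : ℝ} (ha : 0 < a) : IsTransferOp (a • L) where
  nonneg F hF := by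
    rw [LinearMap.smul_apply]
    exact smul_nonneg ha.le (hL.nonneg F hF)
  one_pos := by
    obtain ⟨m, hm, h⟩ := hL.one_pos
    exact ⟨a * m, by positivity, fun x => by
      simpa using mul_le_mul_of_nonneg_left (h x) ha.le⟩
  distortion F hF hF0 ε hε := by
    obtain ⟨δ, hδ, h⟩ := hL.distortion F hF hF0 ε hε
    refine ⟨δ, hδ, fun x x' hd n => ?_⟩
    simp only [smul_pow, LinearMap.smul_apply, Pi.smul_apply, smul_eq_mul]
    calc _ ≤ a ^ n * (Real.exp ε * ((L ^ n) F x' + ε * (L ^ n) 1 x')) := by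
          gcongr; exact h x x' hd n
      _ = _ := by ring
  irreducible δ hδ := by
    obtain ⟨K, c, hc, h⟩ := hL.irreducible δ hδ
    have ha' : 0 < min a 1 := lt_min ha zero_lt_one
    refine ⟨K, (min a 1) ^ K * c, by positivity, fun x z => ?_⟩
    obtain ⟨k, hk, w, hw, hF⟩ := h x z
    refine ⟨k, hk, w, hw, fun F hF0 => ?_⟩
    simp only [smul_pow, LinearMap.smul_apply, Pi.smul_apply, smul_eq_mul]
    have h1 : (min a 1) ^ K ≤ a ^ k :=
      (pow_le_pow_of_le_one ha'.le (min_le_right _ _) hk).trans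
        (pow_le_pow_left₀ ha'.le (min_le_left _ _) k)
    have h2 := hF F hF0
    have h3 : 0 ≤ c * F w := mul_nonneg hc.le (hF0 w)
    calc _ = (min a 1) ^ K * (c * F w) := by ring
      _ ≤ _ := by gcongr

theorem eq_zero_of_fixed (hL : IsTransferOp L) {G : X → ℝ} (hG : Continuous G) (h0 : 0 ≤ G)
    (hfix : L G = G) {x : X} (hx : G x = 0) : G = 0 := by
  have hpow : ∀ k : ℕ, (L ^ k) G = G := by
    intro k
    induction k with
    | zero => simp
    | succ k ih => rw [end_pow_succ_apply, ih, hfix]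
  ext z
  by_contra hz
  have hz' : 0 < G z := lt_of_le_of_ne (h0 z) (Ne.symm hz)
  obtain ⟨δ, hδ, hball⟩ := Metric.isOpen_iff.1 (isOpen_lt continuous_const hG) z hz'
  obtain ⟨K, c, hc, h⟩ := hL.irreducible δ hδ
  obtain ⟨k, -, w, hw, hF⟩ := h x z
  have h1 := hF G h0
  rw [hpow, hx] at h1
  have h2 : 0 < G w := hball hw
  have := mul_pos hc h2
  linarith

theorem fixed_unique [CompactSpace X] [Nonempty X] (hL : IsTransferOp L) {h G : X → ℝ}
    (hh : Continuous h) (hpos : ∀ x, 0 < h x) (hfix : L h = h) (hG : Continuous G)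
    (hGfix : L G = G) : ∃ s : ℝ, G = s • h := by
  obtain ⟨x, -, hx⟩ := isCompact_univ.exists_isMaxOn univ_nonempty
    (f := fun x => G x / h x) (hG.div hh fun x => (hpos x).ne').continuousOn
  refine ⟨G x / h x, ?_⟩
  have := hL.eq_zero_of_fixed (G := (G x / h x) • h - G) ((hh.const_smul _).sub hG)
    (fun y => by
      have : G y / h y ≤ G x / h x := hx (mem_univ y)
      rw [div_le_iff₀ (hpos y)] at this
      simpa using this)
    (by rw [map_sub, map_smul, hfix, hGfix]) (x := x)
    (by have := (hpos x).ne'; simp [this])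
  exact (sub_eq_zero.1 this).symm

section Normalized

variable [CompactSpace X] {c₀ : ℝ}

theorem exists_fixed_limit (hL : IsTransferOp L) (hc₀ : 0 < c₀)
    (hup : ∀ (n : ℕ) x, c₀ * (L ^ n) 1 x ≤ 1) {F : X → ℝ} (hF : Continuous F) :
    ∃ G : X → ℝ, Continuous G ∧ L G = G ∧ ∃ s : ℕ → ℕ, StrictMono s ∧ ∀ ε > 0,
      ∀ᶠ j in atTop, ∀ x, |(((s j : ℝ)⁻¹ • ∑ k ∈ Finset.range (s j), (L ^ k) F) : X → ℝ) x - G x|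
        ≤ ε := by
  obtain ⟨b, hb0, hb⟩ := exists_abs_bound hF
  have up : ∀ (n : ℕ) x, (L ^ n) 1 x ≤ c₀⁻¹ := fun n x => by
    rw [← one_div, le_div_iff₀ hc₀, mul_comm]; exact hup n x
  have hbn : ∀ (n : ℕ) x, |(L ^ n) F x| ≤ b * c₀⁻¹ := by
    intro n x
    have := abs_pow_apply_le hL.nonneg n (F := F) (G := b • 1) (fun y => by simpa using hb y) x
    refine this.trans ?_
    simp only [map_smul, Pi.smul_apply, smul_eq_mul]
    gcongr
    exact up n x
  have havg : ∀ (v : ℕ → ℝ) (B : ℝ), 0 ≤ B → (∀ k, |v k| ≤ B) → ∀ n : ℕ,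
      |(n : ℝ)⁻¹ * ∑ k ∈ Finset.range n, v k| ≤ B := by
    intro v B hB hv n
    rcases Nat.eq_zero_or_pos n with rfl | hn
    · simpa using hB
    have hn' : (0 : ℝ) < n := by exact_mod_cast hn
    rw [abs_mul, abs_of_pos (inv_pos.2 hn'), inv_mul_le_iff₀ hn']
    calc _ ≤ ∑ k ∈ Finset.range n, |v k| := Finset.abs_sum_le_sum_abs _ _
      _ ≤ ∑ k ∈ Finset.range n, B := Finset.sum_le_sum fun k _ => hv k
      _ = _ := by simp
  set u : ℕ → X → ℝ := fun n => (n : ℝ)⁻¹ • ∑ k ∈ Finset.range n, (L ^ k) F with hu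
  have huv : ∀ n x, u n x = (n : ℝ)⁻¹ * ∑ k ∈ Finset.range n, (L ^ k) F x := by
    intro n x; simp [hu]
  obtain ⟨G, hG, s, hs, hlim⟩ := exists_subseq_uniform_limit u (b * c₀⁻¹)
    (fun n x => by
      rw [huv]; exact havg _ _ (by positivity) (fun k => hbn k x) n)
    (by
      intro ε hε
      obtain ⟨δ, hδ, h⟩ := hL.equicontinuous hF (ε := ε * c₀) (by positivity)
      refine ⟨δ, hδ, fun x x' hd n => ?_⟩
      rw [huv, huv, ← mul_sub, ← Finset.sum_sub_distrib]
      refine havg _ _ hε.le (fun k => (h x x' hd k).trans ?_) n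
      have := up k x'
      calc _ ≤ ε * c₀ * c₀⁻¹ := by gcongr
        _ = ε := by field_simp)
  refine ⟨G, hG, ?_, s, hs, hlim⟩
  have hLu : ∀ n x, |L (u n) x - u n x| ≤ (n : ℝ)⁻¹ * (2 * (b * c₀⁻¹)) := by
    intro n x
    have e : L (u n) x - u n x = (n : ℝ)⁻¹ * ((L ^ n) F x - (L ^ 0) F x) := by
      simp only [hu, map_smul, map_sum, ← end_pow_succ_apply]
      rw [← Finset.sum_range_sub (fun k => (L ^ k) F x) n, Finset.sum_sub_distrib]
      simp [mul_sub]
    rw [e, abs_mul, abs_of_nonneg (by positivity)]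
    have := abs_sub ((L ^ n) F x) ((L ^ 0) F x)
    have := hbn n x
    have := hbn 0 x
    gcongr
    linarith
  ext x
  by_contra hne
  have hpos : 0 < |L G x - G x| := abs_pos.2 (sub_ne_zero.2 hne)
  have hlim1 : Tendsto (fun j => ((s j : ℕ) : ℝ)⁻¹ * (2 * (b * c₀⁻¹))) atTop (𝓝 0) := by
    have : Tendsto (fun j => ((s j : ℕ) : ℝ)⁻¹) atTop (𝓝 0) :=
      (tendsto_inv_atTop_zero.comp tendsto_natCast_atTop_atTop).comp hs.tendsto_atTop
    simpa using this.mul_const (2 * (b * c₀⁻¹))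
  have hε : 0 < |L G x - G x| / (3 * (c₀⁻¹ + 1)) := by positivity
  obtain ⟨j, hj1, hj2⟩ := ((hlim _ hε).and (hlim1.eventually_lt_const
    (show (0 : ℝ) < |L G x - G x| / 3 by positivity))).exists
  have h1 : |L (u (s j) - G) x| ≤ |L G x - G x| / (3 * (c₀⁻¹ + 1)) * c₀⁻¹ := by
    have := abs_pow_apply_le hL.nonneg 1 (F := u (s j) - G)
      (G := (|L G x - G x| / (3 * (c₀⁻¹ + 1))) • 1) (fun y => by simpa using hj1 y) x
    simp only [pow_one, map_smul, Pi.smul_apply, smul_eq_mul] at this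
    refine this.trans ?_
    gcongr
    simpa using up 1 x
  have h2 := hj1 x
  have h3 := hLu (s j) x
  rw [map_sub, Pi.sub_apply] at h1
  have h4 : |L G x - G x| / (3 * (c₀⁻¹ + 1)) * c₀⁻¹ + |L G x - G x| / (3 * (c₀⁻¹ + 1))
      = |L G x - G x| / 3 := by field_simp
  have h5 : |L G x - G x| ≤ |L (u (s j)) x - L G x| + |L (u (s j)) x - u (s j) x| +
      |u (s j) x - G x| := by
    rw [abs_sub_comm (L (u (s j)) x) (L G x)]
    refine le_trans (le_of_eq ?_) (abs_add_three _ _ _)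
    congr 1; ring
  linarith

theorem exists_eigenfunction [Nonempty X] (hL : IsTransferOp L) (hc₀ : 0 < c₀)
    (hup : ∀ (n : ℕ) x, c₀ * (L ^ n) 1 x ≤ 1) (hlo : ∀ (n : ℕ) x, c₀ ≤ (L ^ n) 1 x) :
    ∃ h : X → ℝ, Continuous h ∧ (∀ x, 0 < h x) ∧ L h = h := by
  obtain ⟨G, hG, hfix, s, hs, hlim⟩ := hL.exists_fixed_limit hc₀ hup (F := 1) continuous_const
  refine ⟨G, hG, fun x => ?_, hfix⟩
  obtain ⟨j, hj, hj1⟩ := ((hlim (c₀ / 2) (by positivity)).and (eventually_ge_atTop 1)).exists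
  have hsj : (0 : ℝ) < s j := by
    have := hs.id_le j
    have : 1 ≤ s j := le_trans hj1 this
    exact_mod_cast this
  have h1 := le_of_abs_le (hj x)
  have h2 : c₀ ≤ (((s j : ℝ)⁻¹ • ∑ k ∈ Finset.range (s j), (L ^ k) 1) : X → ℝ) x := by
    simp only [Pi.smul_apply, Finset.sum_apply, smul_eq_mul]
    rw [← div_eq_inv_mul, le_div_iff₀ hsj]
    calc c₀ * s j = ∑ k ∈ Finset.range (s j), c₀ := by simp [mul_comm]
      _ ≤ _ := Finset.sum_le_sum fun k _ => hlo k x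
  linarith

/-- First-order control of the growth rate of the operators `F ↦ L (exp (t f) F)` at `t = 0`,
obtained from a multiplicative corrector solving an approximate cohomological equation. -/
theorem exists_tilted_growth [Nonempty X] (hL : IsTransferOp L) (hc₀ : 0 < c₀)
    (hup : ∀ (n : ℕ) x, c₀ * (L ^ n) 1 x ≤ 1) (hlo : ∀ (n : ℕ) x, c₀ ≤ (L ^ n) 1 x)
    {f : X → ℝ} (hf : Continuous f) {ε : ℝ} (hε : 0 < ε) :
    ∃ c τ : ℝ, 0 < τ ∧ ∀ t : ℝ, |t| = τ → ∀ L' : Module.End ℝ (X → ℝ),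
      (∀ F : X → ℝ, L' F = L (fun y => Real.exp (t * f y) * F y)) →
      ∃ C : ℝ, 0 < C ∧ ∀ (n : ℕ) x, (L' ^ n) 1 x ≤ C * Real.exp (t * c + ε * τ) ^ n := by
  obtain ⟨h, hh, hpos, hfix⟩ := hL.exists_eigenfunction hc₀ hup hlo
  obtain ⟨h₀, hh₀, hle⟩ := exists_pos_lower_bound hh hpos
  have hFc : Continuous (h * f) := hh.mul hf
  obtain ⟨G, hG, hGfix, s, hs, hlim⟩ := hL.exists_fixed_limit hc₀ hup hFc
  obtain ⟨c, rfl⟩ := hL.fixed_unique hh hpos hfix hG hGfix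
  obtain ⟨j, hj, hj1⟩ := ((hlim (ε * h₀ / 4 * c₀) (by positivity)).and
    (eventually_ge_atTop 1)).exists
  set N := s j
  have hN : (0 : ℝ) < N := by
    have := hs.id_le j
    have : 1 ≤ s j := le_trans hj1 this
    exact_mod_cast this
  set A : X → ℝ := (N : ℝ)⁻¹ • ∑ k ∈ Finset.range N, (L ^ k) (h * f) with hA
  set W : X → ℝ := (N : ℝ)⁻¹ • ∑ n ∈ Finset.range N, ∑ k ∈ Finset.range (n + 1), (L ^ k) (h * f)
    with hW
  have hWc : Continuous W := by
    have e : W = fun x => (N : ℝ)⁻¹ * ∑ n ∈ Finset.range N, ∑ k ∈ Finset.range (n + 1),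
        (L ^ k) (h * f) x := by
      ext x
      simp [hW]
    rw [e]
    exact continuous_const.mul (continuous_finsetSum _ fun n _ => continuous_finsetSum _
      fun k _ => hL.continuous_pow hFc k)
  have hcoh : L W - W + h * f = L A := by
    have e : ∀ n, L (∑ k ∈ Finset.range (n + 1), (L ^ k) (h * f)) -
        ∑ k ∈ Finset.range (n + 1), (L ^ k) (h * f) = (L ^ (n + 1)) (h * f) - h * f := by
      intro n
      rw [map_sum, ← Finset.sum_sub_distrib]
      simp only [← end_pow_succ_apply]
      rw [Finset.sum_range_sub (fun k => (L ^ k) (h * f))]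
      simp
    have e2 : L W - W = (N : ℝ)⁻¹ • ∑ n ∈ Finset.range N, ((L ^ (n + 1)) (h * f) - h * f) := by
      rw [hW, map_smul, map_sum, ← smul_sub, ← Finset.sum_sub_distrib]
      simp only [e]
    have e3 : (N : ℝ)⁻¹ • (N • (h * f)) = h * f := by
      rw [← Nat.cast_smul_eq_nsmul ℝ, smul_smul, inv_mul_cancel₀ hN.ne', one_smul]
    rw [e2, Finset.sum_sub_distrib, smul_sub, Finset.sum_const, Finset.card_range, e3, hA,
      map_smul, map_sum]
    simp only [end_pow_succ_apply]
    abel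
  have hLA : ∀ x, |L A x - c * h x| ≤ ε * h₀ / 4 := by
    intro x
    have := abs_pow_apply_le hL.nonneg 1 (F := A - c • h)
      (G := (ε * h₀ / 4 * c₀) • 1) (fun y => by simpa using hj y) x
    simp only [pow_one, map_sub, map_smul, hfix, Pi.smul_apply, Pi.sub_apply, smul_eq_mul] at this
    refine this.trans ?_
    have h1 := hup 1 x
    rw [pow_one] at h1
    calc _ = ε * h₀ / 4 * (c₀ * L 1 x) := by ring
      _ ≤ ε * h₀ / 4 * 1 := by gcongr
      _ = _ := by ring
  obtain ⟨b₁, hb₁0, hb₁⟩ := exists_abs_bound hf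
  obtain ⟨b₂, hb₂0, hb₂⟩ := exists_abs_bound hh
  obtain ⟨b₃, hb₃0, hb₃⟩ := exists_abs_bound hWc
  set K : ℝ := 2 * b₁ * (b₂ + b₃) + b₃ with hK
  have hK0 : 0 ≤ K := by positivity
  obtain ⟨τ, ⟨⟨⟨hτ1, hτ2⟩, hτ3⟩, hτ4⟩, hτ0⟩ : ∃ τ : ℝ, (((τ < 1 ∧ τ * b₁ < 1) ∧
      K * τ < h₀ / 2) ∧ τ * (b₁ * b₃ + |c| * K) < ε * h₀ / 4) ∧ 0 < τ := by
    have t1 : Tendsto (fun τ : ℝ => τ) (𝓝[>] 0) (𝓝 0) := tendsto_id.mono_left nhdsWithin_le_nhds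
    have t2 := t1.mul_const b₁
    have t3 := t1.const_mul K
    have t4 := t1.mul_const (b₁ * b₃ + |c| * K)
    rw [zero_mul] at t2 t4
    rw [mul_zero] at t3
    exact ((((t1.eventually_lt_const zero_lt_one).and (t2.eventually_lt_const zero_lt_one)).and
      (t3.eventually_lt_const (by positivity))).and
      (t4.eventually_lt_const (by positivity))).and self_mem_nhdsWithin |>.exists
  refine ⟨c, τ, hτ0, fun t ht L' hL' => ?_⟩
  have hL'0 : ∀ F : X → ℝ, 0 ≤ F → 0 ≤ L' F := fun F hF => by
    rw [hL']
    exact hL.nonneg _ fun y => mul_nonneg (Real.exp_pos _).le (hF y)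
  set H : X → ℝ := fun y => Real.exp (-(t * f y)) * (h y + t * W y) with hH
  have htf : ∀ x, |t * f x| ≤ τ * b₁ := fun x => by
    rw [abs_mul, ht]; gcongr; exact hb₁ x
  have htW : ∀ x, |t * W x| ≤ τ * b₃ := fun x => by
    rw [abs_mul, ht]; gcongr; exact hb₃ x
  have hHh : ∀ x, |H x - h x| ≤ K * τ := by
    intro x
    have e : H x - h x = (Real.exp (-(t * f x)) - 1) * (h x + t * W x) + t * W x := by
      simp only [hH]; ring
    rw [e]
    have h1 : |Real.exp (-(t * f x)) - 1| ≤ 2 * (τ * b₁) := by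
      refine (Real.abs_exp_sub_one_le (by rw [abs_neg]; linarith [htf x])).trans ?_
      rw [abs_neg]
      linarith [htf x]
    have h2 : |h x + t * W x| ≤ b₂ + b₃ := by
      refine (abs_add_le _ _).trans (add_le_add (hb₂ x) ((htW x).trans ?_))
      nlinarith
    calc _ ≤ |(Real.exp (-(t * f x)) - 1) * (h x + t * W x)| + |t * W x| := abs_add_le _ _
      _ ≤ 2 * (τ * b₁) * (b₂ + b₃) + τ * b₃ := by
        rw [abs_mul]
        have := htW x
        gcongr
      _ = _ := by rw [hK]; ring
  have hHlow : ∀ x, h₀ / 2 ≤ H x := fun x => by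
    have := neg_le_of_abs_le (hHh x); linarith [hle x]
  have hHup : ∀ x, H x ≤ b₂ + K * τ := fun x => by
    have := le_of_abs_le (hHh x); linarith [le_of_abs_le (hb₂ x)]
  have hmain : ∀ x, L' H x ≤ Real.exp (t * c + ε * τ) * H x := by
    intro x
    have e1 : L' H = h + t • L W := by
      have e : (fun y => Real.exp (t * f y) * H y) = h + t • W := by
        ext y
        simp only [hH, Pi.add_apply, Pi.smul_apply, smul_eq_mul]
        rw [← mul_assoc, ← Real.exp_add]
        simp
      rw [hL', e, map_add, map_smul, hfix]
    have e2 : L W x = W x - h x * f x + L A x := by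
      rw [← hcoh]; simp
    have e3 : L' H x = h x + t * W x - t * (h x * f x) + t * (c * h x) +
        t * (L A x - c * h x) := by
      rw [e1, Pi.add_apply, Pi.smul_apply, smul_eq_mul, e2]; ring
    have i1 : t * (L A x - c * h x) ≤ τ * (ε * h₀ / 4) := by
      refine (le_abs_self _).trans ?_
      rw [abs_mul, ht]; gcongr; exact hLA x
    have pos : 0 ≤ h x + t * W x := by
      have : 0 ≤ Real.exp (-(t * f x)) * (h x + t * W x) := by linarith [hHlow x]
      exact nonneg_of_mul_nonneg_right this (Real.exp_pos _)
    have i2 : (1 - t * f x) * (h x + t * W x) ≤ H x := by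
      have := Real.add_one_le_exp (-(t * f x))
      simp only [hH]
      gcongr
      linarith
    have i3 : (t * f x) * (t * W x) ≤ (τ * b₁) * (τ * b₃) := by
      refine (le_abs_self _).trans ?_
      rw [abs_mul]
      exact mul_le_mul (htf x) (htW x) (abs_nonneg _) (by positivity)
    have i4 : t * c * (h x - H x) ≤ τ * |c| * (K * τ) := by
      refine (le_abs_self _).trans ?_
      rw [abs_mul, abs_mul, ht, abs_sub_comm]
      gcongr
      exact hHh x
    have i5 : τ * (τ * (b₁ * b₃ + |c| * K)) ≤ τ * (ε * h₀ / 4) := by gcongr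
    have i6 : ε * τ * (h₀ / 2) ≤ ε * τ * H x := by gcongr; exact hHlow x
    have i7 : (t * c + ε * τ + 1) * H x ≤ Real.exp (t * c + ε * τ) * H x := by
      have := hHlow x
      have := Real.add_one_le_exp (t * c + ε * τ)
      gcongr
    rw [e3]
    nlinarith
  refine ⟨2 / h₀ * (b₂ + K * τ), by
    have h1 := hHlow (Classical.arbitrary X)
    have h2 := hHup (Classical.arbitrary X)
    have : 0 < b₂ + K * τ := by linarith
    positivity, fun n x => ?_⟩
  have h1 := pow_apply_mono hL'0 n (F := 1) (G := (2 / h₀) • H) (fun y => by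
    have := hHlow y
    simp only [Pi.one_apply, Pi.smul_apply, smul_eq_mul]
    rw [div_mul_eq_mul_div, le_div_iff₀ hh₀]; linarith) x
  refine h1.trans ?_
  have h2 := pow_apply_le_geometric hL'0 (Real.exp_pos _).le hmain n x
  rw [map_smul, Pi.smul_apply, smul_eq_mul]
  calc _ ≤ 2 / h₀ * (Real.exp (t * c + ε * τ) ^ n * H x) := by gcongr
    _ ≤ 2 / h₀ * (Real.exp (t * c + ε * τ) ^ n * (b₂ + K * τ)) := by gcongr; exact hHup x
    _ = _ := by ring

end Normalized

end IsTransferOp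

/-- Uniform convergence of `Lⁿ f / Lⁿ 1` under uniform exactness. -/
theorem IsTransferOp.exists_ratio_limit {X : Type*} [MetricSpace X] [CompactSpace X] [Nonempty X]
    {L : Module.End ℝ (X → ℝ)} (hL : IsTransferOp L)
    (hexact : ∀ δ > 0, ∃ N : ℕ, ∃ c > 0, ∀ x z, ∃ w, dist w z < δ ∧
      ∀ F : X → ℝ, 0 ≤ F → c * F w ≤ (L ^ N) F x) {f : X → ℝ} (hf : Continuous f) :
    ∃ r : ℝ, ∀ ε > 0, ∀ᶠ n in atTop, ∀ x,
      |(L ^ n) f x - r * (L ^ n) 1 x| ≤ ε * (L ^ n) 1 x := by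
  set R : ℕ → X → ℝ := fun n x => (L ^ n) f x / (L ^ n) 1 x with hR
  have h1c : Continuous (1 : X → ℝ) := continuous_const
  have hRc : ∀ n, Continuous (R n) := fun n =>
    (hL.continuous_pow hf n).div (hL.continuous_pow h1c n) fun x => (hL.pow_one_pos n x).ne'
  have hRf : ∀ n x, (L ^ n) f x = R n x * (L ^ n) 1 x := fun n x =>
    (div_mul_cancel₀ _ (hL.pow_one_pos n x).ne').symm
  have hmax : ∀ n, ∃ p, ∀ x, R n x ≤ R n p := fun n => by
    obtain ⟨p, -, hp⟩ := isCompact_univ.exists_isMaxOn univ_nonempty (hRc n).continuousOn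
    exact ⟨p, fun x => hp (mem_univ x)⟩
  have hmin : ∀ n, ∃ q, ∀ x, R n q ≤ R n x := fun n => by
    obtain ⟨p, -, hp⟩ := isCompact_univ.exists_isMinOn univ_nonempty (hRc n).continuousOn
    exact ⟨p, fun x => hp (mem_univ x)⟩
  choose p hp using hmax
  choose q hq using hmin
  have hup : ∀ n, (L ^ n) f ≤ R n (p n) • (L ^ n) 1 := fun n x => by
    rw [hRf, Pi.smul_apply, smul_eq_mul]
    exact mul_le_mul_of_nonneg_right (hp n x) (hL.pow_one_pos n x).le
  have hlo : ∀ n, R n (q n) • (L ^ n) 1 ≤ (L ^ n) f := fun n x => by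
    rw [hRf, Pi.smul_apply, smul_eq_mul]
    exact mul_le_mul_of_nonneg_right (hq n x) (hL.pow_one_pos n x).le
  have hanti : Antitone fun n => R n (p n) := antitone_nat_of_succ_le fun n => by
    have := apply_mono hL.nonneg (hup n) (p (n + 1))
    rw [map_smul, ← end_pow_succ_apply, ← end_pow_succ_apply, hRf, Pi.smul_apply,
      smul_eq_mul] at this
    exact le_of_mul_le_mul_right this (hL.pow_one_pos _ _)
  have hmono : Monotone fun n => R n (q n) := monotone_nat_of_le_succ fun n => by
    have := apply_mono hL.nonneg (hlo n) (q (n + 1))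
    rw [map_smul, ← end_pow_succ_apply, ← end_pow_succ_apply, hRf, Pi.smul_apply,
      smul_eq_mul] at this
    exact le_of_mul_le_mul_right this (hL.pow_one_pos _ _)
  have hle : ∀ n k, R n (q n) ≤ R k (p k) := fun n k =>
    (hmono (le_max_left n k)).trans ((hq _ _).trans (hanti (le_max_right n k)))
  obtain ⟨s, hs⟩ : ∃ s, Tendsto (fun n => R n (p n)) atTop (𝓝 s) :=
    ⟨_, tendsto_atTop_ciInf hanti ⟨R 0 (q 0), by rintro _ ⟨n, rfl⟩; exact hle 0 n⟩⟩
  obtain ⟨i, hi⟩ : ∃ i, Tendsto (fun n => R n (q n)) atTop (𝓝 i) :=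
    ⟨_, tendsto_atTop_ciSup hmono ⟨R 0 (p 0), by rintro _ ⟨n, rfl⟩; exact hle n 0⟩⟩
  have hsle : ∀ n, s ≤ R n (p n) := fun n => hanti.le_of_tendsto hs n
  have hile : ∀ n, R n (q n) ≤ i := fun n => hmono.ge_of_tendsto hi n
  have hsi : s ≤ i := by
    by_contra! hlt
    set ε := (s - i) / 2 with hε
    have hε0 : 0 < ε := by rw [hε]; linarith
    set K := max |R 0 (p 0)| |R 0 (q 0)| with hK
    have hK0 : 0 ≤ K := (abs_nonneg _).trans (le_max_left _ _)
    have hSK : ∀ n, |R n (p n)| ≤ K := fun n => abs_le_max_abs_abs (hle 0 n) (hanti n.zero_le)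
      |>.trans (max_comm _ _).le
    obtain ⟨δ₁, hδ₁, e₁⟩ := hL.equicontinuous hf (ε := ε / 2) (by positivity)
    obtain ⟨δ₂, hδ₂, e₂⟩ := hL.equicontinuous h1c (ε := ε / (2 * (K + 1))) (by positivity)
    obtain ⟨N, c, hc, hN⟩ := hexact (min δ₁ δ₂) (lt_min hδ₁ hδ₂)
    obtain ⟨c₁, hc₁, hratio⟩ := hL.exists_ratio_bound
    obtain ⟨C, hC1, hC⟩ := hL.exists_one_le_bound
    have hC0 : 0 < C := by linarith
    have hdrop : ∀ n, R (N + n) (p (N + n)) ≤ R n (p n) - c * ε * c₁ / C ^ N := by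
      intro n
      set x := p (N + n)
      set S := R n (p n)
      have hq0 := hL.pow_one_pos n (q n)
      obtain ⟨w, hw, hF⟩ := hN x (q n)
      have g1 := e₁ w (q n) (hw.trans_le (min_le_left _ _)) n
      have g2 := e₂ w (q n) (hw.trans_le (min_le_right _ _)) n
      have g3 : ε * (L ^ n) 1 (q n) ≤ S * (L ^ n) 1 w - (L ^ n) f w := by
        have a1 : 2 * ε * (L ^ n) 1 (q n) ≤ S * (L ^ n) 1 (q n) - (L ^ n) f (q n) := by
          rw [hRf n (q n), ← sub_mul]
          have := hsle n
          have := hile n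
          gcongr
          linarith
        have a2 : |S * ((L ^ n) 1 w - (L ^ n) 1 (q n))| ≤ ε / 2 * (L ^ n) 1 (q n) := by
          rw [abs_mul]
          calc _ ≤ K * (ε / (2 * (K + 1)) * (L ^ n) 1 (q n)) :=
                mul_le_mul (hSK n) g2 (abs_nonneg _) hK0
            _ = K / (K + 1) * (ε / 2 * (L ^ n) 1 (q n)) := by field_simp
            _ ≤ 1 * (ε / 2 * (L ^ n) 1 (q n)) := by
                gcongr
                rw [div_le_one (by positivity)]
                linarith
            _ = _ := one_mul _
        have a3 := (abs_le.1 a2).1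
        have a4 := (abs_le.1 g1).2
        linarith
      have g4 := hF (S • (L ^ n) 1 - (L ^ n) f) (sub_nonneg.2 (hup n))
      rw [map_sub, map_smul, ← end_pow_add_apply, ← end_pow_add_apply] at g4
      simp only [Pi.sub_apply, Pi.smul_apply, smul_eq_mul] at g4
      rw [hRf (N + n) x, ← sub_mul] at g4
      have g5 : c₁ * (L ^ (N + n)) 1 x ≤ C ^ N * (L ^ n) 1 (q n) := by
        rw [end_pow_add_apply]
        have b1 := pow_apply_mono hL.nonneg N (F := c₁ • (L ^ n) 1)
          (G := (L ^ n) 1 (q n) • 1) (fun y => by simpa using hratio n (q n) y) x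
        rw [map_smul, map_smul] at b1
        simp only [Pi.smul_apply, smul_eq_mul] at b1
        have b2 := pow_one_le_geometric hL.nonneg hC0.le hC N x
        calc _ ≤ _ := b1
          _ ≤ (L ^ n) 1 (q n) * C ^ N := by gcongr
          _ = _ := mul_comm _ _
      have g6 : c * ε * c₁ / C ^ N * (L ^ (N + n)) 1 x ≤
          (S - R (N + n) x) * (L ^ (N + n)) 1 x := by
        calc _ = c * ε / C ^ N * (c₁ * (L ^ (N + n)) 1 x) := by ring
          _ ≤ c * ε / C ^ N * (C ^ N * (L ^ n) 1 (q n)) := by gcongr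
          _ = c * (ε * (L ^ n) 1 (q n)) := by field_simp
          _ ≤ c * (S * (L ^ n) 1 w - (L ^ n) f w) := by gcongr
          _ ≤ _ := g4
      have := le_of_mul_le_mul_right g6 (hL.pow_one_pos _ _)
      linarith
    have ht : Tendsto (fun n => R (N + n) (p (N + n))) atTop (𝓝 s) := by
      simpa only [add_comm N] using (tendsto_add_atTop_iff_nat (f := fun n => R n (p n)) N).2 hs
    have := le_of_tendsto_of_tendsto' ht (hs.sub_const _) hdrop
    have : 0 < c * ε * c₁ / C ^ N := by positivity
    linarith
  refine ⟨s, fun ε hε => ?_⟩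
  filter_upwards [hs.eventually_lt_const (show s < s + ε by linarith),
    hi.eventually_const_lt (show i - ε < i by linarith)] with n hn1 hn2 x
  have := hL.pow_one_pos n x
  rw [hRf, ← sub_mul, abs_mul, abs_of_pos this]
  gcongr
  have := hp n x
  have := hq n x
  rw [abs_le]
  constructor <;> linarith

/-! ### Transfer operators of correspondences with finite fibres -/

/-- The sum `∑ ψ (yᵢ, yᵢ₊₁)` along a finite path. -/
def pathSum {X : Type*} (ψ : X × X → ℝ) {n : ℕ} (y : Fin (n + 1) → X) : ℝ :=
  ∑ i : Fin n, ψ (y i.castSucc, y i.succ)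

theorem snoc_zero {X : Type*} {n : ℕ} (y : Fin (n + 1) → X) (x : X) :
    (Fin.snoc y x : Fin (n + 2) → X) 0 = y 0 :=
  Fin.snoc_castSucc (α := fun _ => X) x y 0

theorem pathSum_snoc {X : Type*} (ψ : X × X → ℝ) {n : ℕ} (y : Fin (n + 1) → X) (x : X) :
    pathSum ψ (Fin.snoc y x : Fin (n + 2) → X) = pathSum ψ y + ψ (y (Fin.last n), x) := by
  unfold pathSum
  rw [Fin.sum_univ_castSucc]
  congr 1
  · refine Finset.sum_congr rfl fun i _ => ?_
    rw [Fin.snoc_castSucc, ← Fin.castSucc_succ, Fin.snoc_castSucc]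
  · rw [Fin.snoc_castSucc, Fin.succ_last, Fin.snoc_last]

theorem isFinOrbit_snoc {X : Type*} {T : X → Set X} {n : ℕ} {y : Fin (n + 1) → X} {x : X} :
    IsFinOrbit T (Fin.snoc y x : Fin (n + 2) → X) ↔ IsFinOrbit T y ∧ x ∈ T (y (Fin.last n)) := by
  unfold IsFinOrbit
  rw [Fin.forall_fin_succ']
  refine and_congr (forall_congr' fun i => ?_) ?_
  · rw [Fin.snoc_castSucc, ← Fin.castSucc_succ, Fin.snoc_castSucc]
  · rw [Fin.snoc_castSucc, Fin.succ_last, Fin.snoc_last]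

theorem snoc_mem_backOrbits {X : Type*} {T : X → Set X} {n : ℕ} {y : Fin (n + 1) → X}
    {w x : X} (hy : y ∈ backOrbits T n w) (hw : x ∈ T w) :
    (Fin.snoc y x : Fin (n + 2) → X) ∈ backOrbits T (n + 1) x :=
  ⟨isFinOrbit_snoc.2 ⟨hy.1, by rwa [hy.2]⟩, Fin.snoc_last _ _⟩

theorem init_mem_backOrbits {X : Type*} {T : X → Set X} {n : ℕ} {z : Fin (n + 2) → X}
    {x : X} (hz : z ∈ backOrbits T (n + 1) x) :
    Fin.init z ∈ backOrbits T n (z (Fin.last n).castSucc) ∧ x ∈ T (z (Fin.last n).castSucc) := by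
  obtain ⟨h, rfl⟩ := hz
  rw [← Fin.snoc_init_self z, isFinOrbit_snoc] at h
  exact ⟨⟨h.1, rfl⟩, h.2⟩

theorem backOrbits_succ {X : Type*} (T : X → Set X) (n : ℕ) (x : X) :
    backOrbits T (n + 1) x =
      ⋃ w ∈ {w | x ∈ T w}, (fun y => (Fin.snoc y x : Fin (n + 2) → X)) '' backOrbits T n w := by
  ext z
  simp only [mem_iUnion, mem_image, mem_ofPred_eq, exists_prop]
  constructor
  · intro hz
    obtain ⟨h1, h2⟩ := init_mem_backOrbits hz
    refine ⟨_, h2, _, h1, ?_⟩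
    rw [← hz.2]
    exact Fin.snoc_init_self z
  · rintro ⟨w, hw, y, hy, rfl⟩
    exact snoc_mem_backOrbits hy hw

section FiniteFibres

variable {X : Type*} {T : X → Set X} (hfin : ∀ x, {y | x ∈ T y}.Finite)

theorem backOrbits_finite {T : X → Set X} (hfin : ∀ x, {y | x ∈ T y}.Finite) (n : ℕ) (x : X) :
    (backOrbits T n x).Finite := by
  induction n generalizing x with
  | zero =>
    refine (finite_singleton (fun _ : Fin 1 => x)).subset fun y hy => ?_
    rw [mem_singleton_iff]
    ext i
    rw [Fin.fin_one_eq_zero i]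
    exact hy.2
  | succ n ih =>
    rw [backOrbits_succ]
    exact (hfin x).biUnion fun w _ => (ih w).image _

/-- The transfer operator `F ↦ ∑_{x ∈ T y} exp (ψ (y, x)) F y`. -/
noncomputable def transferOp (ψ : X × X → ℝ) : Module.End ℝ (X → ℝ) where
  toFun F x := ∑ y ∈ (hfin x).toFinset, Real.exp (ψ (y, x)) * F y
  map_add' F G := by
    ext x
    simp only [Pi.add_apply, mul_add, Finset.sum_add_distrib]
  map_smul' a F := by
    ext x
    simp only [Pi.smul_apply, smul_eq_mul, RingHom.id_apply, Finset.mul_sum]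
    exact Finset.sum_congr rfl fun y _ => by ring

theorem transferOp_apply (ψ : X × X → ℝ) (F : X → ℝ) (x : X) :
    transferOp hfin ψ F x = ∑ y ∈ (hfin x).toFinset, Real.exp (ψ (y, x)) * F y := rfl

theorem transferOp_pow_apply (ψ : X × X → ℝ) (F : X → ℝ) (n : ℕ) (x : X) :
    (transferOp hfin ψ ^ n) F x =
      ∑ y ∈ (backOrbits_finite hfin n x).toFinset, Real.exp (pathSum ψ y) * F (y 0) := by
  induction n generalizing x with
  | zero =>
    have : (backOrbits_finite hfin 0 x).toFinset = {fun _ => x} := by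
      ext y
      rw [Finite.mem_toFinset, Finset.mem_singleton]
      constructor
      · intro hy
        ext i
        rw [Fin.fin_one_eq_zero i]
        exact hy.2
      · rintro rfl
        exact ⟨fun i => i.elim0, rfl⟩
    rw [this]
    simp [pathSum]
  | succ n ih =>
    rw [end_pow_succ_apply, transferOp_apply]
    simp only [ih, Finset.mul_sum]
    rw [Finset.sum_sigma']
    refine Finset.sum_bij' (fun p _ => (Fin.snoc p.2 x : Fin (n + 2) → X))
      (fun z _ => ⟨z (Fin.last n).castSucc, Fin.init z⟩) ?_ ?_ ?_ ?_ ?_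
    · rintro ⟨w, y⟩ h
      simp only [Finset.mem_sigma, Finite.mem_toFinset, mem_ofPred_eq] at h ⊢
      exact snoc_mem_backOrbits h.2 h.1
    · intro z hz
      simp only [Finset.mem_sigma, Finite.mem_toFinset, mem_ofPred_eq] at hz ⊢
      exact (init_mem_backOrbits hz).symm
    · rintro ⟨w, y⟩ h
      simp only [Finset.mem_sigma, Finite.mem_toFinset, mem_ofPred_eq] at h ⊢
      rw [Fin.snoc_castSucc, Fin.init_snoc, h.2.2]
    · intro z hz
      rw [Finite.mem_toFinset] at hz
      rw [← hz.2]
      exact Fin.snoc_init_self z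
    · rintro ⟨w, y⟩ h
      simp only [Finset.mem_sigma, Finite.mem_toFinset, mem_ofPred_eq] at h ⊢
      rw [pathSum_snoc, h.2.2, snoc_zero, Real.exp_add]
      ring

theorem transferOp_nonneg (ψ : X × X → ℝ) (F : X → ℝ) (hF : 0 ≤ F) :
    0 ≤ transferOp hfin ψ F := fun _ =>
  Finset.sum_nonneg fun y _ => mul_nonneg (Real.exp_pos _).le (hF y)

theorem transferOp_pow_one_apply (ψ : X × X → ℝ) (n : ℕ) (x : X) :
    (transferOp hfin ψ ^ n) 1 x =
      ∑ y ∈ (backOrbits_finite hfin n x).toFinset, Real.exp (pathSum ψ y) := by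
  simp [transferOp_pow_apply]

theorem exp_pathSum_mul_le_transferOp_pow (ψ : X × X → ℝ) {F : X → ℝ} (hF : 0 ≤ F) {n : ℕ} {x : X}
    {y : Fin (n + 1) → X} (hy : y ∈ backOrbits T n x) :
    Real.exp (pathSum ψ y) * F (y 0) ≤ (transferOp hfin ψ ^ n) F x := by
  rw [transferOp_pow_apply]
  exact Finset.single_le_sum (f := fun y : Fin (n + 1) → X => Real.exp (pathSum ψ y) * F (y 0))
    (fun y _ => mul_nonneg (Real.exp_pos _).le (hF _))
    ((Finite.mem_toFinset _).2 hy)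

theorem transferOp_tilt (ψ : X × X → ℝ) (t : ℝ) (f F : X → ℝ) :
    transferOp hfin (fun p => ψ p + t * f p.1) F =
      transferOp hfin ψ (fun y => Real.exp (t * f y) * F y) := by
  ext x
  simp only [transferOp_apply, Real.exp_add]
  exact Finset.sum_congr rfl fun y _ => by ring

end FiniteFibres

theorem pathSum_tilt {X : Type*} (ψ : X × X → ℝ) (t : ℝ) (f : X → ℝ) {n : ℕ}
    (y : Fin (n + 1) → X) :
    pathSum (fun p => ψ p + t * f p.1) y =
      pathSum ψ y + t * ((∑ j : Fin (n + 1), f (y j)) - f (y (Fin.last n))) := by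
  simp only [pathSum, Finset.sum_add_distrib, ← Finset.mul_sum]
  rw [Fin.sum_univ_castSucc, add_sub_cancel_right]

/-! ### Expanding correspondences: separation and shadowing of backward orbits -/

/-- `z` is an infinite backward orbit: `z (i + 1)` is a preimage of `z i`. -/
def IsBackSeq {X : Type*} (T : X → Set X) (z : ℕ → X) : Prop := ∀ i, z i ∈ T (z (i + 1))

section Combinatorics

variable {X : Type*} {T : X → Set X}

theorem corrIter_nonempty (hne : ∀ x, (T x).Nonempty) {A : Set X} (hA : A.Nonempty) (n : ℕ) :
    (corrIter T n A).Nonempty := by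
  induction n with
  | zero => exact hA
  | succ n ih =>
    obtain ⟨u, hu⟩ := ih
    obtain ⟨v, hv⟩ := hne u
    exact ⟨v, mem_biUnion hu hv⟩

theorem corrIter_subset_corrIter_succ {x y : X} (h : x ∈ T y) (n : ℕ) :
    corrIter T n {x} ⊆ corrIter T (n + 1) {y} := by
  induction n with
  | zero =>
    rintro _ rfl
    exact mem_biUnion (mem_singleton y) h
  | succ n ih => exact biUnion_mono ih fun _ _ => subset_rfl

theorem IsBackSeq.mem_corrIter {z : ℕ → X} (hz : IsBackSeq T z) (k i : ℕ) :
    z i ∈ corrIter T k {z (i + k)} := by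
  induction k generalizing i with
  | zero => exact mem_singleton _
  | succ k ih =>
    have := ih (i + 1)
    rw [show i + 1 + k = i + (k + 1) by omega] at this
    exact mem_biUnion this (hz i)

theorem IsBackSeq.mem_backOrbits {z : ℕ → X} (hz : IsBackSeq T z) (n : ℕ) :
    (fun i : Fin (n + 1) => z (n - i)) ∈ backOrbits T n (z 0) := by
  refine ⟨fun i => ?_, by simp⟩
  have := hz (n - (i + 1))
  rw [show n - (i + 1 : ℕ) + 1 = n - i by omega] at this
  simpa using this

theorem exists_isBackSeq (hsurj : ∀ x, ∃ y, x ∈ T y) {n : ℕ} {x : X} {y : Fin (n + 1) → X}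
    (hy : y ∈ backOrbits T n x) :
    ∃ z, IsBackSeq T z ∧ z 0 = x ∧ ∀ i : Fin (n + 1), z (n - i) = y i := by
  choose g hg using hsurj
  obtain ⟨Y, hY⟩ : ∃ Y : ℕ → X, ∀ i : Fin (n + 1), Y i = y i :=
    ⟨fun k => if h : k < n + 1 then y ⟨k, h⟩ else x, fun i => dif_pos i.2⟩
  have hYT : ∀ k < n, Y (k + 1) ∈ T (Y k) := fun k hk => by
    have := hy.1 ⟨k, hk⟩
    rw [← hY, ← hY] at this
    exact this
  refine ⟨fun j => if j ≤ n then Y (n - j) else g^[j - n] (Y 0), fun j => ?_, ?_, fun i => ?_⟩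
  · rcases lt_trichotomy j n with h | rfl | h
    · simp only [h.le, Nat.succ_le_of_lt h, if_true]
      have := hYT (n - (j + 1)) (by omega)
      rwa [show n - (j + 1) + 1 = n - j by omega] at this
    · simpa using hg (Y 0)
    · simp only [show ¬ j ≤ n by omega, show ¬ j + 1 ≤ n by omega, if_false,
        show j + 1 - n = (j - n) + 1 by omega, Function.iterate_succ_apply']
      exact hg _
  · simp only [Nat.zero_le, if_true, Nat.sub_zero, ← hy.2]
    exact hY (Fin.last n)
  · have := i.2
    simp only [Nat.sub_le, if_true, ← hY]
    congr 1
    omega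

theorem cons_mem_backOrbits {n : ℕ} {y : Fin (n + 1) → X} {w x : X} (hy : y ∈ backOrbits T n x)
    (hw : y 0 ∈ T w) : (Fin.cons w y : Fin (n + 2) → X) ∈ backOrbits T (n + 1) x := by
  refine ⟨fun i => ?_, ?_⟩
  · refine Fin.cases ?_ (fun j => ?_) i
    · simpa using hw
    · rw [Fin.cons_succ, ← Fin.succ_castSucc, Fin.cons_succ]
      exact hy.1 j
  · rw [← Fin.succ_last, Fin.cons_succ]
    exact hy.2

theorem exists_backOrbit_of_mem_corrPreIter {x : X} (n : ℕ) {w : X}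
    (hw : w ∈ corrPreIter T n {x}) : ∃ y ∈ backOrbits T n x, y 0 = w := by
  induction n generalizing w with
  | zero =>
    rw [show w = x from hw]
    exact ⟨fun _ => x, ⟨fun i => i.elim0, rfl⟩, rfl⟩
  | succ n ih =>
    obtain ⟨u, hu, huw⟩ := hw
    obtain ⟨y, hy, rfl⟩ := ih hu
    exact ⟨Fin.cons w y, cons_mem_backOrbits hy huw, rfl⟩

theorem exists_backOrbit_of_mem_corrIter {A : Set X} (n : ℕ) {x : X}
    (hx : x ∈ corrIter T n A) : ∃ y ∈ backOrbits T n x, y 0 ∈ A := by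
  induction n generalizing x with
  | zero => exact ⟨fun _ => x, ⟨fun i => i.elim0, rfl⟩, hx⟩
  | succ n ih =>
    obtain ⟨u, hu, hux⟩ := mem_iUnion₂.1 hx
    obtain ⟨y, hy, hyA⟩ := ih hu
    exact ⟨Fin.snoc y x, snoc_mem_backOrbits hy hux, by rwa [snoc_zero]⟩

end Combinatorics

section Expanding

variable {X : Type*} [MetricSpace X] {T : X → Set X}

theorem DistanceExpanding.exists_separation (hne : ∀ x, (T x).Nonempty)
    (h : DistanceExpanding T) :
    ∃ η > 0, ∀ x y y', x ∈ T y → x ∈ T y' → dist y y' ≤ η → y = y' := by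
  obtain ⟨lam, hlam, η, hη, n, hn, h⟩ := h
  refine ⟨η, hη, fun x y y' hy hy' hd => ?_⟩
  obtain ⟨k, rfl⟩ : ∃ k, n = k + 1 := ⟨n - 1, by omega⟩
  obtain ⟨u, hu⟩ := corrIter_nonempty hne (singleton_nonempty x) k
  have := h y y' hd u (corrIter_subset_corrIter_succ hy k hu) u
    (corrIter_subset_corrIter_succ hy' k hu)
  rw [dist_self] at this
  exact dist_le_zero.1 (nonpos_of_mul_nonpos_right this (by linarith))

theorem finite_preimages [CompactSpace X] {η : ℝ} (hη : 0 < η)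
    (hsep : ∀ x y y', x ∈ T y → x ∈ T y' → dist y y' ≤ η → y = y') (x : X) :
    {y | x ∈ T y}.Finite := by
  obtain ⟨t, -, ht, hcov⟩ := finite_cover_balls_of_compact (isCompact_univ (X := X))
    (half_pos hη)
  refine (ht.biUnion (t := fun c => {y | x ∈ T y} ∩ Metric.ball c (η / 2)) fun c _ =>
    Subsingleton.finite fun y hy y' hy' => hsep x y y' hy.1 hy'.1 ?_).subset fun y hy => ?_
  · have h1 := Metric.mem_ball.1 hy.2
    have h2 := Metric.mem_ball.1 hy'.2
    linarith [dist_triangle_right y y' c]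
  · obtain ⟨c, hc, hyc⟩ := mem_iUnion₂.1 (hcov (mem_univ y))
    exact mem_biUnion hc ⟨hy, hyc⟩

theorem eq_of_mem_backOrbits {η : ℝ}
    (hsep : ∀ x y y', x ∈ T y → x ∈ T y' → dist y y' ≤ η → y = y') {n : ℕ} {x : X}
    {y y' : Fin (n + 1) → X} (hy : y ∈ backOrbits T n x) (hy' : y' ∈ backOrbits T n x)
    (hd : ∀ i, dist (y i) (y' i) ≤ η) : y = y' := by
  ext i
  induction i using Fin.reverseInduction with
  | last => rw [hy.2, hy'.2]
  | cast i ih =>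
    have h := hy.1 i
    rw [ih] at h
    exact hsep _ _ _ h (hy'.1 i) (hd _)

theorem StronglyTransitive.exists_preimage (h : StronglyTransitive T) (x : X) : ∃ y, x ∈ T y := by
  obtain ⟨w, -, hw⟩ := (h x).inter_open_nonempty univ isOpen_univ ⟨x, trivial⟩
  obtain ⟨n, hn⟩ := mem_iUnion.1 hw
  obtain ⟨y, hy, -⟩ := exists_backOrbit_of_mem_corrPreIter (n + 1) hn
  exact ⟨_, (init_mem_backOrbits hy).2⟩

theorem exists_close_preimage [CompactSpace X] (hT : IsCorrespondence T) (hopen : IsOpenCorr T)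
    {ε : ℝ} (hε : 0 < ε) : ∃ δ > 0, ∀ x x', dist x x' < δ → ∀ y, x ∈ T y →
      ∃ y', x' ∈ T y' ∧ dist y y' < ε := by
  by_contra! hcon
  have hpos : ∀ n : ℕ, (0 : ℝ) < 1 / (n + 1) := fun n => Nat.one_div_pos_of_nat
  choose x x' hxx' y hy hyfar using fun n : ℕ => hcon _ (hpos n)
  obtain ⟨⟨a, b⟩, -, s, hs, hlim⟩ := (isCompact_univ (X := X × X)).tendsto_subseq
    (x := fun n => (y n, x n)) fun _ => mem_univ _
  have hab : b ∈ T a := hT.2.2.mem_of_tendsto hlim (Eventually.of_forall fun n => hy (s n))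
  have hya : Tendsto (fun n => y (s n)) atTop (𝓝 a) := (continuous_fst.tendsto _).comp hlim
  have hxb : Tendsto (fun n => x (s n)) atTop (𝓝 b) := (continuous_snd.tendsto _).comp hlim
  have hd : Tendsto (fun n => dist (x (s n)) (x' (s n))) atTop (𝓝 0) :=
    squeeze_zero (fun _ => dist_nonneg) (fun n => (hxx' (s n)).le)
      (tendsto_one_div_add_atTop_nhds_zero_nat.comp hs.tendsto_atTop)
  have hx'b : Tendsto (fun n => x' (s n)) atTop (𝓝 b) := (tendsto_iff_of_dist hd).1 hxb
  have hU : corrImage T (Metric.ball a (ε / 2)) ∈ 𝓝 b :=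
    (hopen _ Metric.isOpen_ball).mem_nhds
      (mem_biUnion (Metric.mem_ball_self (half_pos hε)) hab)
  obtain ⟨n, hn1, hn2⟩ := ((hx'b.eventually hU).and
    (hya.eventually (Metric.ball_mem_nhds a (half_pos hε)))).exists
  obtain ⟨u, hu, hux⟩ := mem_iUnion₂.1 hn1
  have h1 := hyfar (s n) u hux
  have h2 := Metric.mem_ball.1 hu
  have h3 := Metric.mem_ball.1 hn2
  linarith [dist_triangle_right (y (s n)) u a]

theorem exists_shadowing [CompactSpace X] (hT : IsCorrespondence T) (hopen : IsOpenCorr T)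
    (hsurj : ∀ x, ∃ y, x ∈ T y) (hdexp : DistanceExpanding T) :
    ∃ θ : ℝ, 0 < θ ∧ θ < 1 ∧ ∀ ε > 0, ∃ δ > 0, ∀ z, IsBackSeq T z → ∀ x', dist (z 0) x' < δ →
      ∃ z', IsBackSeq T z' ∧ z' 0 = x' ∧ ∀ i, dist (z i) (z' i) ≤ ε * θ ^ i := by
  obtain ⟨η₀, hη₀, hsep⟩ := hdexp.exists_separation hT.1
  have hfin := finite_preimages hη₀ hsep
  obtain ⟨lam, hlam, η, hη, N, hN, hexp⟩ := hdexp
  have hlam0 : 0 < lam := by linarith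
  have hN0 : N ≠ 0 := by omega
  obtain ⟨θ, hθ0, hθ1, hθ⟩ : ∃ θ : ℝ, 0 < θ ∧ θ < 1 ∧ θ ^ N = lam⁻¹ :=
    ⟨lam⁻¹ ^ (N : ℝ)⁻¹, by positivity,
      Real.rpow_lt_one (by positivity) (inv_lt_one_of_one_lt₀ hlam) (by positivity),
      Real.rpow_inv_natCast_pow (by positivity) hN0⟩
  have hmin : ∀ x' w : X, ∃ m, x' ∈ T m ∧ ∀ w', x' ∈ T w' → dist w m ≤ dist w w' := fun x' w => by
    obtain ⟨m, hm, h⟩ := exists_min_image _ (dist w) (hfin x') (hsurj x')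
    exact ⟨m, hm, h⟩
  choose m hm hmle using hmin
  let follow : (ℕ → X) → X → ℕ → X := fun z x' i => Nat.rec x' (fun i p => m p (z (i + 1))) i
  have hback : ∀ z x', IsBackSeq T (follow z x') := fun z x' i => hm _ _
  have hblock : ∀ k : ℕ, ∀ ε > 0, ∃ δ > 0, ∀ z, IsBackSeq T z → ∀ x' j,
      dist (z j) (follow z x' j) < δ → ∀ i ≤ k, dist (z (j + i)) (follow z x' (j + i)) < ε := by
    intro k
    induction k with
    | zero =>
      intro ε hε
      refine ⟨ε, hε, fun z _ x' j hd i hi => ?_⟩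
      rw [Nat.le_zero.1 hi]
      exact hd
    | succ k ih =>
      intro ε hε
      obtain ⟨δ₁, hδ₁, h₁⟩ := exists_close_preimage hT hopen hε
      obtain ⟨δ₂, hδ₂, h₂⟩ := ih (min δ₁ ε) (lt_min hδ₁ hε)
      refine ⟨δ₂, hδ₂, fun z hz x' j hd i hi => ?_⟩
      have key := h₂ z hz x' j hd
      rcases Nat.le_succ_iff.1 hi with h | rfl
      · exact (key i h).trans_le (min_le_right _ _)
      · obtain ⟨y', hy', hd'⟩ := h₁ _ _ ((key k le_rfl).trans_le (min_le_left _ _))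
          (z (j + k + 1)) (hz (j + k))
        exact (hmle _ _ _ hy').trans_lt hd'
  refine ⟨θ, hθ0, hθ1, fun ε hε => ?_⟩
  obtain ⟨δ, hδ, hδN⟩ := hblock N (min η (ε * θ ^ N)) (lt_min hη (by positivity))
  refine ⟨δ, hδ, fun z hz x' hd => ⟨follow z x', hback z x', rfl, ?_⟩⟩
  have hcontr : ∀ i, dist (z (i + N)) (follow z x' (i + N)) ≤ η →
      dist (z (i + N)) (follow z x' (i + N)) ≤ θ ^ N * dist (z i) (follow z x' i) := by
    intro i hi
    have := hexp _ _ hi _ (hz.mem_corrIter N i) _ ((hback z x').mem_corrIter N i)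
    rw [hθ, inv_mul_eq_div, le_div_iff₀' hlam0]
    exact this
  have hpow1 : θ ^ N ≤ 1 := pow_le_one₀ hθ0.le hθ1.le
  have hq : ∀ q, dist (z (N * q)) (follow z x' (N * q)) < δ := by
    intro q
    induction q with
    | zero => exact hd
    | succ q ih =>
      have h1 := hδN z hz x' _ ih N le_rfl
      have h2 := hcontr _ (h1.le.trans (min_le_left _ _))
      rw [mul_add, mul_one]
      calc _ ≤ _ := h2
        _ ≤ 1 * dist (z (N * q)) (follow z x' (N * q)) := by gcongr
        _ < δ := by rwa [one_mul]
  have hall : ∀ i, dist (z i) (follow z x' i) < min η (ε * θ ^ N) := by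
    intro i
    have := hδN z hz x' _ (hq (i / N)) (i % N) (Nat.mod_lt _ hN).le
    rwa [Nat.div_add_mod] at this
  intro i
  induction i using Nat.strong_induction_on with
  | _ i ih =>
    rcases lt_or_ge i N with h | h
    · refine (hall i).le.trans ((min_le_right _ _).trans ?_)
      have := pow_le_pow_of_le_one hθ0.le hθ1.le h.le
      gcongr
    · obtain ⟨j, rfl⟩ := Nat.exists_eq_add_of_le' h
      calc _ ≤ _ := hcontr j ((hall _).le.trans (min_le_left _ _))
        _ ≤ θ ^ N * (ε * θ ^ j) := by gcongr; exact ih j (by omega)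
        _ = _ := by ring

end Expanding

theorem ext2_of_mem {X : Type*} {T : X → Set X} {φ : ↥(graph2 T) → ℝ} {p : X × X}
    (hp : p ∈ graph2 T) : ext2 T φ p = φ ⟨p, hp⟩ := dif_pos hp

theorem domRestrict_ext2 {X : Type*} {T : X → Set X} {φ : ↥(graph2 T) → ℝ} :
    (graph2 T).domRestrict (ext2 T φ) = φ := by
  ext p
  exact ext2_of_mem p.2

section HolderPotential

variable {X : Type*} [MetricSpace X] {T : X → Set X} {φ : ↥(graph2 T) → ℝ}

theorem HolderOn.continuous (h : HolderOn T φ) : Continuous φ := by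
  obtain ⟨C, hC, α, hα, -, h⟩ := h
  rw [continuous_iff_continuousAt]
  intro a
  rw [ContinuousAt, tendsto_iff_dist_tendsto_zero]
  have h0 : Tendsto (fun b : ↥(graph2 T) => C * dist (b : X × X) (a : X × X) ^ α) (𝓝 a) (𝓝 0) := by
    have : Continuous fun b : ↥(graph2 T) => C * dist (b : X × X) (a : X × X) ^ α :=
      continuous_const.mul ((continuous_subtype_val.dist continuous_const).rpow_const
        fun _ => Or.inr hα.le)
    have := this.tendsto a
    rwa [dist_self, Real.zero_rpow hα.ne', mul_zero] at this
  exact squeeze_zero (fun _ => dist_nonneg) (fun b => (Real.dist_eq _ _).trans_le (h b a)) h0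

theorem HolderOn.continuousOn_ext2 (h : HolderOn T φ) : ContinuousOn (ext2 T φ) (graph2 T) := by
  rw [continuousOn_iff_continuous_domRestrict, domRestrict_ext2]
  exact h.continuous

theorem exists_abs_ext2_le [CompactSpace X] (hT : IsCorrespondence T) (h : HolderOn T φ) :
    ∃ M : ℝ, 0 ≤ M ∧ ∀ p, |ext2 T φ p| ≤ M := by
  have hc : IsCompact (graph2 T) := IsClosed.isCompact hT.2.2
  obtain ⟨M, hM⟩ := hc.exists_bound_of_continuousOn h.continuousOn_ext2
  refine ⟨max M 0, le_max_right _ _, fun p => ?_⟩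
  by_cases hp : p ∈ graph2 T
  · exact (hM p hp).trans (le_max_left _ _)
  · rw [ext2, dif_neg hp, abs_zero]
    exact le_max_right _ _

end HolderPotential

theorem pathSum_reverse {X : Type*} (ψ : X × X → ℝ) (z : ℕ → X) (n : ℕ) :
    pathSum ψ (fun i : Fin (n + 1) => z (n - i)) = ∑ j ∈ Finset.range n, ψ (z (j + 1), z j) := by
  rw [← Finset.sum_range_reflect, Finset.sum_range]
  refine Finset.sum_congr rfl fun i _ => ?_
  have := i.2
  simp only [Fin.val_castSucc, Fin.val_succ]
  congr 3 <;> omega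

theorem pathSum_le {X : Type*} {ψ : X × X → ℝ} {M : ℝ} (hM : ∀ p, |ψ p| ≤ M) {n : ℕ}
    (y : Fin (n + 1) → X) : |pathSum ψ y| ≤ n * M := by
  refine (Finset.abs_sum_le_sum_abs _ _).trans ((Finset.sum_le_sum fun i _ => hM _).trans ?_)
  simp

section Distortion

variable {X : Type*} [MetricSpace X] [CompactSpace X] {T : X → Set X} {φ : ↥(graph2 T) → ℝ}

/-- Backward orbits ending at nearby points can be matched with small distortion. -/
theorem exists_backOrbit_matching (hT : IsCorrespondence T) (hopen : IsOpenCorr T)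
    (htrans : StronglyTransitive T) (hdexp : DistanceExpanding T) (hφ : HolderOn T φ)
    {ε : ℝ} (hε : 0 < ε) : ∃ δ > 0, ∀ x x', dist x x' < δ → ∀ (n : ℕ), ∀ y ∈ backOrbits T n x,
      ∃ y' ∈ backOrbits T n x', (∀ i, dist (y i) (y' i) ≤ ε) ∧
        |pathSum (ext2 T φ) y - pathSum (ext2 T φ) y'| ≤ ε := by
  obtain ⟨θ, hθ0, hθ1, hsh⟩ := exists_shadowing hT hopen htrans.exists_preimage hdexp
  obtain ⟨C, hC, α, hα, -, hφ⟩ := hφ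
  have hθα : θ ^ α < 1 := Real.rpow_lt_one hθ0.le hθ1 hα
  have hb : 0 < ε * (1 - θ ^ α) / C := by
    have : 0 < 1 - θ ^ α := by linarith
    positivity
  set ρ := min ε ((ε * (1 - θ ^ α) / C) ^ α⁻¹) with hρ
  have hρ0 : 0 < ρ := lt_min hε (by positivity)
  have hρα : C * ρ ^ α ≤ ε * (1 - θ ^ α) := by
    have : ρ ^ α ≤ ε * (1 - θ ^ α) / C := by
      calc ρ ^ α ≤ ((ε * (1 - θ ^ α) / C) ^ α⁻¹) ^ α :=
            Real.rpow_le_rpow hρ0.le (min_le_right _ _) hα.le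
        _ = _ := Real.rpow_inv_rpow hb.le hα.ne'
    rwa [le_div_iff₀' hC] at this
  obtain ⟨δ, hδ, h⟩ := hsh ρ hρ0
  refine ⟨δ, hδ, fun x x' hxx' n y hy => ?_⟩
  obtain ⟨z, hz, rfl, hzy⟩ := exists_isBackSeq htrans.exists_preimage hy
  obtain ⟨z', hz', rfl, hd⟩ := h z hz x' hxx'
  obtain rfl : y = fun i : Fin (n + 1) => z (n - i) := funext fun i => (hzy i).symm
  refine ⟨_, hz'.mem_backOrbits n, fun i => (hd _).trans ?_, ?_⟩
  · calc ρ * θ ^ (n - i.val) ≤ ε * 1 := by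
          have := pow_le_one₀ (n := n - i.val) hθ0.le hθ1.le
          have := min_le_left ε ((ε * (1 - θ ^ α) / C) ^ α⁻¹)
          gcongr
      _ = ε := mul_one _
  · rw [pathSum_reverse, pathSum_reverse, ← Finset.sum_sub_distrib]
    refine (Finset.abs_sum_le_sum_abs _ _).trans ?_
    have hterm : ∀ j ∈ Finset.range n, |ext2 T φ (z (j + 1), z j) -
        ext2 T φ (z' (j + 1), z' j)| ≤ C * ρ ^ α * (θ ^ α) ^ j := by
      intro j _
      have m1 : (z (j + 1), z j) ∈ graph2 T := hz j
      have m2 : (z' (j + 1), z' j) ∈ graph2 T := hz' j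
      rw [ext2_of_mem m1, ext2_of_mem m2]
      have hdist : dist (z (j + 1), z j) (z' (j + 1), z' j) ≤ ρ * θ ^ j := by
        rw [Prod.dist_eq]
        refine max_le ((hd _).trans ?_) (hd _)
        have := pow_le_pow_of_le_one hθ0.le hθ1.le (Nat.le_succ j)
        gcongr
      calc _ ≤ C * dist (z (j + 1), z j) (z' (j + 1), z' j) ^ α := hφ ⟨_, m1⟩ ⟨_, m2⟩
        _ ≤ C * (ρ * θ ^ j) ^ α := by gcongr
        _ = C * ρ ^ α * (θ ^ α) ^ j := by
          rw [Real.mul_rpow hρ0.le (by positivity), ← Real.rpow_natCast, ← Real.rpow_natCast,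
            ← Real.rpow_mul hθ0.le, ← Real.rpow_mul hθ0.le, mul_comm α]
          ring
    refine (Finset.sum_le_sum hterm).trans ?_
    rw [← Finset.mul_sum]
    have hgeom : ∑ j ∈ Finset.range n, (θ ^ α) ^ j ≤ (1 - θ ^ α)⁻¹ := by
      rw [← tsum_geometric_of_lt_one (by positivity) hθα]
      exact (summable_geometric_of_lt_one (by positivity) hθα).sum_le_tsum _
        fun _ _ => by positivity
    have hpos : 0 < 1 - θ ^ α := by linarith
    calc _ ≤ ε * (1 - θ ^ α) * (1 - θ ^ α)⁻¹ := by gcongr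
      _ = ε := mul_inv_cancel_right₀ hpos.ne' _

theorem StronglyTransitive.exists_uniform_backOrbit (hT : IsCorrespondence T)
    (hopen : IsOpenCorr T) (htrans : StronglyTransitive T) (hdexp : DistanceExpanding T)
    (hφ : HolderOn T φ) {δ : ℝ} (hδ : 0 < δ) :
    ∃ K : ℕ, ∀ x z, ∃ k ≤ K, ∃ y ∈ backOrbits T k x, dist (y 0) z < δ := by
  obtain ⟨ρ, hρ, hmatch⟩ := exists_backOrbit_matching hT hopen htrans hdexp hφ
    (show 0 < δ / 3 by positivity)
  have hloc : ∀ p : X × X, ∃ k, ∃ y ∈ backOrbits T k p.1, dist (y 0) p.2 < δ / 3 := by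
    intro p
    obtain ⟨w, hw, hwU⟩ := (htrans p.1).inter_open_nonempty _ Metric.isOpen_ball
      ⟨p.2, Metric.mem_ball_self (show 0 < δ / 3 by positivity)⟩
    obtain ⟨n, hn⟩ := mem_iUnion.1 hwU
    obtain ⟨y, hy, rfl⟩ := exists_backOrbit_of_mem_corrPreIter (n + 1) hn
    exact ⟨_, y, hy, hw⟩
  choose k y hy hd using hloc
  obtain ⟨t, -, ht⟩ := (isCompact_univ (X := X × X)).elim_nhds_subcover
    (fun p => Metric.ball p (min ρ (δ / 3)))
    (fun p _ => Metric.ball_mem_nhds p (lt_min hρ (by positivity)))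
  refine ⟨t.sup k, fun x z => ?_⟩
  obtain ⟨p, hp, hxz⟩ := mem_iUnion₂.1 (ht (mem_univ (x, z)))
  rw [Metric.mem_ball, Prod.dist_eq, max_lt_iff] at hxz
  obtain ⟨y', hy', hclose, -⟩ := hmatch p.1 x
    (by rw [dist_comm]; exact hxz.1.trans_le (min_le_left _ _)) _ _ (hy p)
  refine ⟨k p, Finset.le_sup hp, y', hy', ?_⟩
  have h1 := hclose 0
  have h2 := hd p
  have h3 := hxz.2.trans_le (min_le_right _ _)
  rw [dist_comm] at h1
  have := dist_triangle4 (y' 0) (y p 0) p.2 z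
  rw [dist_comm p.2 z] at this
  linarith

theorem TopologicallyExact.exists_uniform_backOrbit (hsurj : ∀ x, ∃ y, x ∈ T y)
    (h : TopologicallyExact T) {δ : ℝ} (hδ : 0 < δ) :
    ∃ N : ℕ, ∀ x z, ∃ y ∈ backOrbits T N x, dist (y 0) z < δ := by
  obtain ⟨t, -, ht, hcov⟩ := finite_cover_balls_of_compact (isCompact_univ (X := X))
    (half_pos hδ)
  choose N _ hN using fun c : X => h (Metric.ball c (δ / 2)) Metric.isOpen_ball
    ⟨c, Metric.mem_ball_self (half_pos hδ)⟩
  have hmore : ∀ c k, corrIter T (N c + k) (Metric.ball c (δ / 2)) = univ := by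
    intro c k
    induction k with
    | zero => exact hN c
    | succ k ih =>
      rw [← add_assoc]
      change corrImage T (corrIter T (N c + k) (Metric.ball c (δ / 2))) = univ
      rw [ih, eq_univ_iff_forall]
      intro x
      obtain ⟨y, hy⟩ := hsurj x
      exact mem_biUnion (mem_univ y) hy
  refine ⟨ht.toFinset.sup N, fun x z => ?_⟩
  obtain ⟨c, hc, hzc⟩ := mem_iUnion₂.1 (hcov (mem_univ z))
  obtain ⟨k, hk⟩ := Nat.exists_eq_add_of_le (Finset.le_sup (f := N) (ht.mem_toFinset.2 hc))
  obtain ⟨y, hy, hyc⟩ := exists_backOrbit_of_mem_corrIter (T := T) (A := Metric.ball c (δ / 2))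
    (ht.toFinset.sup N) (x := x) (by rw [hk, hmore]; trivial)
  refine ⟨y, hy, ?_⟩
  have h1 := Metric.mem_ball.1 hyc
  have h2 := Metric.mem_ball.1 hzc
  linarith [dist_triangle_right (y 0) z c]

theorem isTransferOp_transferOp (hT : IsCorrespondence T) (hopen : IsOpenCorr T)
    (htrans : StronglyTransitive T) (hdexp : DistanceExpanding T) (hφ : HolderOn T φ)
    (hfin : ∀ x, {y | x ∈ T y}.Finite) : IsTransferOp (transferOp hfin (ext2 T φ)) where
  nonneg := transferOp_nonneg hfin _
  one_pos := by
    obtain ⟨M, hM0, hM⟩ := exists_abs_ext2_le hT hφ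
    refine ⟨Real.exp (-M), Real.exp_pos _, fun x => ?_⟩
    obtain ⟨y, hy⟩ := htrans.exists_preimage x
    have h1 := Finset.single_le_sum (f := fun y => Real.exp (ext2 T φ (y, x)) * (1 : X → ℝ) y)
      (fun y _ => mul_nonneg (Real.exp_pos _).le zero_le_one) ((hfin x).mem_toFinset.2 hy)
    refine le_trans ?_ h1
    simpa using neg_le_of_abs_le (hM (y, x))
  distortion F hF hF0 ε hε := by
    obtain ⟨η, hη, hsep⟩ := hdexp.exists_separation hT.1
    obtain ⟨ρ, hρ, hFρ⟩ := Metric.uniformContinuous_iff.1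
      (CompactSpace.uniformContinuous_of_continuous hF) ε hε
    obtain ⟨δ, hδ, hmatch⟩ := exists_backOrbit_matching hT hopen htrans hdexp hφ
      (show 0 < min ε (min (η / 2) (ρ / 2)) by positivity)
    refine ⟨δ, hδ, fun x x' hxx' n => ?_⟩
    choose! g hg hgd hgs using hmatch x x' hxx' n
    have hinj : InjOn g (backOrbits T n x) := by
      intro y hy y' hy' hgg
      refine eq_of_mem_backOrbits hsep hy hy' fun i => ?_
      have h1 := hgd y hy i
      have h2 := hgd y' hy' i
      rw [← hgg] at h2
      have h3 := (min_le_right ε (min (η / 2) (ρ / 2))).trans (min_le_left _ _)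
      linarith [dist_triangle_right (y i) (y' i) (g y i)]
    rw [transferOp_pow_apply, transferOp_pow_apply, transferOp_pow_apply, Finset.mul_sum,
      ← Finset.sum_add_distrib, Finset.mul_sum]
    calc ∑ y ∈ (backOrbits_finite hfin n x).toFinset,
          Real.exp (pathSum (ext2 T φ) y) * F (y 0)
        ≤ ∑ y ∈ (backOrbits_finite hfin n x).toFinset,
          Real.exp ε * (Real.exp (pathSum (ext2 T φ) (g y)) * F (g y 0) +
            ε * (Real.exp (pathSum (ext2 T φ) (g y)) * (1 : X → ℝ) (g y 0))) := by
          refine Finset.sum_le_sum fun y hy => ?_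
          rw [Finite.mem_toFinset] at hy
          have h1 : Real.exp (pathSum (ext2 T φ) y) ≤
              Real.exp ε * Real.exp (pathSum (ext2 T φ) (g y)) := by
            rw [← Real.exp_add]
            have := le_of_abs_le ((hgs y hy).trans (min_le_left _ _))
            gcongr
            linarith
          have h2 : F (y 0) ≤ F (g y 0) + ε := by
            have h3 := (min_le_right ε (min (η / 2) (ρ / 2))).trans (min_le_right _ _)
            have := hFρ (a := y 0) (b := g y 0) (by linarith [hgd y hy 0])
            rw [Real.dist_eq] at this
            linarith [le_of_abs_le this.le]
          have h3 : 0 ≤ F (y 0) := hF0 _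
          calc _ ≤ (Real.exp ε * Real.exp (pathSum (ext2 T φ) (g y))) * (F (g y 0) + ε) := by
                gcongr
            _ = _ := by rw [Pi.one_apply]; ring
      _ = ∑ y ∈ (backOrbits_finite hfin n x).toFinset.image g,
          Real.exp ε * (Real.exp (pathSum (ext2 T φ) y) * F (y 0) +
            ε * (Real.exp (pathSum (ext2 T φ) y) * (1 : X → ℝ) (y 0))) := by
          rw [Finset.sum_image]
          simpa using hinj
      _ ≤ _ := by
          refine Finset.sum_le_sum_of_subset_of_nonneg ?_ fun y _ _ => ?_
          · intro w hw
            obtain ⟨y, hy, rfl⟩ := Finset.mem_image.1 hw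
            rw [Finite.mem_toFinset] at hy ⊢
            exact hg y hy
          · have : 0 ≤ F (y 0) := hF0 _
            simp only [Pi.one_apply]
            positivity
  irreducible δ hδ := by
    obtain ⟨M, hM0, hM⟩ := exists_abs_ext2_le hT hφ
    obtain ⟨K, hK⟩ := htrans.exists_uniform_backOrbit hT hopen hdexp hφ hδ
    refine ⟨K, Real.exp (-(K * M)), Real.exp_pos _, fun x z => ?_⟩
    obtain ⟨k, hk, y, hy, hyz⟩ := hK x z
    refine ⟨k, hk, y 0, hyz, fun F hF => ?_⟩
    refine le_trans ?_ (exp_pathSum_mul_le_transferOp_pow hfin _ hF hy)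
    have h1 := neg_le_of_abs_le (pathSum_le hM y)
    have h2 : (k : ℝ) * M ≤ K * M := by gcongr
    have h3 : 0 ≤ F (y 0) := hF _
    gcongr
    linarith

theorem TopologicallyExact.transferOp_lower_bound (hT : IsCorrespondence T)
    (hsurj : ∀ x, ∃ y, x ∈ T y) (h : TopologicallyExact T) (hφ : HolderOn T φ)
    (hfin : ∀ x, {y | x ∈ T y}.Finite) {δ : ℝ} (hδ : 0 < δ) :
    ∃ N : ℕ, ∃ c > 0, ∀ x z, ∃ w, dist w z < δ ∧
      ∀ F : X → ℝ, 0 ≤ F → c * F w ≤ (transferOp hfin (ext2 T φ) ^ N) F x := by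
  obtain ⟨M, hM0, hM⟩ := exists_abs_ext2_le hT hφ
  obtain ⟨N, hN⟩ := h.exists_uniform_backOrbit hsurj hδ
  refine ⟨N, Real.exp (-(N * M)), Real.exp_pos _, fun x z => ?_⟩
  obtain ⟨y, hy, hyz⟩ := hN x z
  refine ⟨y 0, hyz, fun F hF => ?_⟩
  refine le_trans ?_ (exp_pathSum_mul_le_transferOp_pow hfin _ hF hy)
  have h1 := neg_le_of_abs_le (pathSum_le hM y)
  have h3 : 0 ≤ F (y 0) := hF _
  gcongr

end Distortion

/-! ### Eigenmeasures and the initial-point averages -/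

theorem tendsto_ratio_of_eigenmeasure {X : Type*} [MetricSpace X] [CompactSpace X] [Nonempty X]
    [MeasurableSpace X] [BorelSpace X] {L : Module.End ℝ (X → ℝ)} (hL : IsTransferOp L)
    (hexact : ∀ δ > 0, ∃ N : ℕ, ∃ c > 0, ∀ x z, ∃ w, dist w z < δ ∧
      ∀ F : X → ℝ, 0 ≤ F → c * F w ≤ (L ^ N) F x)
    (m : Measure X) [IsProbabilityMeasure m] {a : ℝ} (ha : 0 < a)
    (hm : ∀ f : X → ℝ, Continuous f → ∫ x, L f x ∂m = a * ∫ x, f x ∂m)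
    {f : X → ℝ} (hf : Continuous f) (x : X) :
    Tendsto (fun n => (L ^ n) f x / (L ^ n) 1 x) atTop (𝓝 (∫ x, f x ∂m)) := by
  have h1c : Continuous (1 : X → ℝ) := continuous_const
  have hpow : ∀ g : X → ℝ, Continuous g → ∀ n, ∫ x, (L ^ n) g x ∂m = a ^ n * ∫ x, g x ∂m := by
    intro g hg n
    induction n with
    | zero => simp
    | succ n ih =>
      simp only [end_pow_succ_apply]
      rw [hm _ (hL.continuous_pow hg n), ih]
      ring
  have hint : ∀ g : X → ℝ, Continuous g → Integrable g m := fun g hg =>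
    hg.integrable_of_hasCompactSupport (HasCompactSupport.of_compactSpace g)
  obtain ⟨r, hr⟩ := hL.exists_ratio_limit hexact hf
  have hr_eq : ∫ x, f x ∂m = r := by
    refine eq_of_abs_sub_le_all fun ε hε => ?_
    obtain ⟨n, hn⟩ := (hr ε hε).exists
    have i1 := hint _ (hL.continuous_pow hf n)
    have i2 := hint _ (hL.continuous_pow h1c n)
    have h1 : |∫ x, ((L ^ n) f x - r * (L ^ n) 1 x) ∂m| ≤ ∫ x, ε * (L ^ n) 1 x ∂m := by
      refine (abs_integral_le_integral_abs).trans ?_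
      exact integral_mono (i1.sub (i2.const_mul r)).abs (i2.const_mul ε) hn
    rw [integral_sub i1 (i2.const_mul r), integral_const_mul, integral_const_mul, hpow f hf,
      hpow 1 h1c] at h1
    simp only [Pi.one_apply, integral_const, probReal_univ, smul_eq_mul, mul_one] at h1
    have han : 0 < a ^ n := pow_pos ha n
    rw [show a ^ n * ∫ x, f x ∂m - r * a ^ n = a ^ n * (∫ x, f x ∂m - r) by ring, abs_mul,
      abs_of_pos han, mul_comm] at h1
    exact le_of_mul_le_mul_right h1 han
  rw [hr_eq, Metric.tendsto_nhds]
  intro ε hε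
  filter_upwards [hr (ε / 2) (half_pos hε)] with n hn
  have hp := hL.pow_one_pos n x
  rw [Real.dist_eq, ← mul_lt_mul_iff_left₀ hp]
  calc _ = |(L ^ n) f x - r * (L ^ n) 1 x| := by
        rw [← abs_of_pos hp, ← abs_mul, abs_of_pos hp, sub_mul, div_mul_cancel₀ _ hp.ne']
    _ ≤ ε / 2 * (L ^ n) 1 x := hn x
    _ < _ := by gcongr; linarith

theorem ruelleL_comp_zero {X : Type*} {T : X → Set X} (φ : ↥(graph2 T) → ℝ)
    (hfin : ∀ x, {y | x ∈ T y}.Finite) (f : X → ℝ) (z : ↥(orbitSpace T)) :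
    ruelleL T φ (fun y => f (y.1 0)) z = transferOp hfin (ext2 T φ) f (z.1 0) := by
  rw [transferOp_apply, ← finsum_mem_eq_finite_toFinset_sum]
  have hshift : ∀ y : ↥(orbitSpace T), shiftOrb T y = z ↔ ∀ k, y.1 (k + 1) = z.1 k := fun y => by
    rw [Subtype.ext_iff, funext_iff]
    rfl
  refine finsum_mem_eq_of_bijOn (s := {y | shiftOrb T y = z}) (fun y => y.1 0) ⟨?_, ?_, ?_⟩ ?_
  · intro y hy
    have h := (hshift y).1 hy 0
    change z.1 0 ∈ T (y.1 0)
    rw [← h]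
    exact y.2 0
  · intro y hy y' hy' h0
    ext k
    cases k with
    | zero => exact h0
    | succ k => rw [(hshift y).1 hy, (hshift y').1 hy']
  · intro w hw
    refine ⟨⟨fun k => Nat.casesOn k w z.1, fun k => ?_⟩, (hshift _).2 fun k => rfl, rfl⟩
    cases k with
    | zero => exact hw
    | succ k => exact z.2 k
  · intro y hy
    have h := (hshift y).1 hy 0
    have hm : (y.1 0, z.1 0) ∈ graph2 T := by
      change z.1 0 ∈ T (y.1 0)
      rw [← h]
      exact y.2 0
    rw [ext2_of_mem hm, mul_comm]
    congr 2
    unfold liftPhi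
    congr 2
    rw [← h]

section PressureBound

variable {X : Type*} [MetricSpace X] {T : X → Set X} {φ : ↥(graph2 T) → ℝ}

theorem le_sepSup {η : ℝ} (hsep : ∀ x y y', x ∈ T y → x ∈ T y' → dist y y' ≤ η → y = y')
    (hfin : ∀ x, {y | x ∈ T y}.Finite) {ε : ℝ} (hε : ε ≤ η) (n : ℕ) (x : X) :
    ENNReal.ofReal ((transferOp hfin (ext2 T φ) ^ n) 1 x) ≤ sepSup T φ n ε := by
  have hE : eSep ε (backOrbits T n x) := by
    intro y hy y' hy' hne
    by_contra! hlt
    exact hne (eq_of_mem_backOrbits hsep hy hy' fun i =>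
      (dist_le_pi_dist y y' i).trans (hlt.le.trans hε))
  have hsum : orbSum T φ n (backOrbits T n x) =
      ENNReal.ofReal ((transferOp hfin (ext2 T φ) ^ n) 1 x) := by
    rw [transferOp_pow_one_apply, ENNReal.ofReal_sum_of_nonneg fun _ _ => (Real.exp_pos _).le]
    unfold orbSum
    have e := (backOrbits_finite hfin n x).coe_toFinset
    rw [← Finset.tsum_subtype]
    rw [tsum_congr_set_coe (fun y => ENNReal.ofReal (Real.exp (birkhoff T φ y))) e.symm]
    rfl
  rw [← hsum]
  exact le_iSup₂_of_le (backOrbits T n x) (fun y hy => hy.1) (le_iSup_of_le hE le_rfl)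

theorem log_le_elog {a : ℝ} (ha : 0 < a) {b : ℝ≥0∞} (h : ENNReal.ofReal a ≤ b) :
    ((Real.log a : ℝ) : EReal) ≤ elog b := by
  unfold elog
  have hb : b ≠ 0 := (lt_of_lt_of_le (ENNReal.ofReal_pos.2 ha) h).ne'
  rw [if_neg hb]
  split_ifs with ht
  · exact le_top
  · rw [EReal.coe_le_coe_iff]
    exact Real.log_le_log ha ((ENNReal.ofReal_le_iff_le_toReal ht).1 h)

theorem log_le_pressure {η : ℝ} (hη : 0 < η)
    (hsep : ∀ x y y', x ∈ T y → x ∈ T y' → dist y y' ≤ η → y = y')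
    (hfin : ∀ x, {y | x ∈ T y}.Finite) {Λ c : ℝ} (hΛ : 0 < Λ) (hc : 0 < c) (x : X)
    (h : ∀ n, c * Λ ^ n ≤ (transferOp hfin (ext2 T φ) ^ n) 1 x) :
    ((Real.log Λ : ℝ) : EReal) ≤ pressure T φ := by
  have hε : ∀ᶠ ε in 𝓝[>] (0 : ℝ), ((Real.log Λ : ℝ) : EReal) ≤ pressSepEps T φ ε := by
    filter_upwards [Ioc_mem_nhdsGT hη] with ε hε
    have hlim : Tendsto (fun n : ℕ => (((n : ℝ)⁻¹ * Real.log c + Real.log Λ : ℝ) : EReal)) atTop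
        (𝓝 ((Real.log Λ : ℝ) : EReal)) := by
      refine (continuous_coe_real_ereal.tendsto _).comp ?_
      simpa using (tendsto_inv_atTop_nhds_zero_nat (𝕜 := ℝ)).mul_const (Real.log c)
        |>.add_const (Real.log Λ)
    rw [← hlim.limsup_eq]
    refine limsup_le_limsup ?_
    filter_upwards [eventually_ge_atTop 1] with n hn
    have hn0 : (0 : ℝ) < n := by exact_mod_cast hn
    have h1 : 0 < c * Λ ^ n := by positivity
    have h2 := log_le_elog h1 ((ENNReal.ofReal_le_ofReal (h n)).trans
      (le_sepSup hsep hfin hε.2 n x))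
    calc (((n : ℝ)⁻¹ * Real.log c + Real.log Λ : ℝ) : EReal)
        = (((n : ℝ)⁻¹ : ℝ) : EReal) * ((Real.log (c * Λ ^ n) : ℝ) : EReal) := by
          rw [← EReal.coe_mul, Real.log_mul hc.ne' (by positivity), Real.log_pow]
          congr 1
          field_simp
      _ ≤ _ := mul_le_mul_of_nonneg_left h2 (EReal.coe_nonneg.2 (by positivity))
  exact le_limsup_of_frequently_le' hε.frequently

end PressureBound

/-! ### Laws of Markov chains -/

section MarkovLaw

variable {X : Type*} [MeasurableSpace X] {μ : Measure X} {Q : X → Measure X}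

theorem measurable_snoc {n : ℕ} :
    Measurable fun p : (Fin (n + 1) → X) × X => (Fin.snoc p.1 p.2 : Fin (n + 2) → X) := by
  rw [measurable_pi_iff]
  intro i
  refine Fin.lastCases ?_ (fun j => ?_) i
  · simpa only [Fin.snoc_last] using measurable_snd
  · simp only [Fin.snoc_castSucc]
    exact (measurable_pi_apply j).comp measurable_fst

theorem measurable_init {n : ℕ} : Measurable (Fin.init : (Fin (n + 2) → X) → Fin (n + 1) → X) :=
  measurable_pi_iff.2 fun i => measurable_pi_apply i.castSucc

/-- A transition kernel as a bundled kernel. -/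
def IsTransKernel.toKernel (hQ : IsTransKernel Q) : ProbabilityTheory.Kernel X X := ⟨Q, hQ.1⟩

theorem IsTransKernel.isMarkovKernel (hQ : IsTransKernel Q) :
    ProbabilityTheory.IsMarkovKernel hQ.toKernel := ⟨hQ.2⟩

theorem IsTransKernel.measurable_map_snoc (hQ : IsTransKernel Q) {n : ℕ} :
    Measurable fun x : Fin (n + 1) → X =>
      (Q (x (Fin.last n))).map fun y => (Fin.snoc x y : Fin (n + 2) → X) := by
  have := hQ.isMarkovKernel
  refine Measure.measurable_of_measurable_coe _ fun s hs => ?_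
  have h : ∀ x : Fin (n + 1) → X, Measurable fun y => (Fin.snoc x y : Fin (n + 2) → X) :=
    fun x => measurable_snoc.comp measurable_prodMk_left
  simp only [Measure.map_apply (h _) hs]
  exact ProbabilityTheory.Kernel.measurable_kernel_prodMk_left
    (κ := hQ.toKernel.comap (fun x : Fin (n + 1) → X => x (Fin.last n)) (measurable_pi_apply _))
    (measurable_snoc hs)

theorem markovLaw_succ_apply (hQ : IsTransKernel Q) {n : ℕ} {s : Set (Fin (n + 2) → X)}
    (hs : MeasurableSet s) : markovLaw μ Q (n + 1) s =
      ∫⁻ x, Q (x (Fin.last n)) {y | (Fin.snoc x y : Fin (n + 2) → X) ∈ s} ∂markovLaw μ Q n := by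
  rw [markovLaw, Measure.bind_apply hs hQ.measurable_map_snoc.aemeasurable]
  refine lintegral_congr fun x => ?_
  have h : Measurable fun y => (Fin.snoc x y : Fin (n + 2) → X) :=
    measurable_snoc.comp measurable_prodMk_left
  rw [Measure.map_apply h hs]
  rfl

theorem isProbabilityMeasure_markovLaw [IsProbabilityMeasure μ] (hQ : IsTransKernel Q) (n : ℕ) :
    IsProbabilityMeasure (markovLaw μ Q n) := by
  induction n with
  | zero =>
    exact Measure.isProbabilityMeasure_map
      (measurable_pi_iff.2 fun _ => measurable_id).aemeasurable
  | succ n ih =>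
    refine ⟨?_⟩
    have := hQ.2
    rw [markovLaw_succ_apply hQ MeasurableSet.univ]
    simp

theorem map_init_markovLaw (hQ : IsTransKernel Q) (n : ℕ) :
    (markovLaw μ Q (n + 1)).map Fin.init = markovLaw μ Q n := by
  have := hQ.2
  ext s hs
  rw [Measure.map_apply measurable_init hs, markovLaw_succ_apply hQ (measurable_init hs)]
  simp only [mem_preimage, Fin.init_snoc]
  rw [← lintegral_indicator_one hs]
  refine lintegral_congr fun x => ?_
  by_cases hx : x ∈ s <;> simp [hx]

theorem map_last_markovLaw_succ (hQ : IsTransKernel Q) (n : ℕ) :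
    (markovLaw μ Q (n + 1)).map (fun x => x (Fin.last (n + 1))) =
      ((markovLaw μ Q n).map fun x => x (Fin.last n)).bind Q := by
  ext s hs
  have h : Measurable fun a => Q a s := (Measure.measurable_coe hs).comp hQ.1
  rw [Measure.map_apply (measurable_pi_apply _) hs,
    markovLaw_succ_apply hQ (measurable_pi_apply _ hs), Measure.bind_apply hs hQ.1.aemeasurable,
    lintegral_map h (measurable_pi_apply _)]
  refine lintegral_congr fun x => ?_
  simp only [mem_preimage, Fin.snoc_last]
  rfl

theorem map_eval_markovLaw (hQ : IsTransKernel Q) (hinv : μ.bind Q = μ) {n : ℕ}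
    (i : Fin (n + 1)) : (markovLaw μ Q n).map (fun x => x i) = μ := by
  induction n with
  | zero =>
    have h : Measurable fun (x : X) (_ : Fin 1) => x := measurable_pi_iff.2 fun _ => measurable_id
    rw [markovLaw, Measure.map_map (measurable_pi_apply _) h]
    exact Measure.map_id
  | succ n ih =>
    refine Fin.lastCases ?_ (fun j => ?_) i
    · rw [map_last_markovLaw_succ hQ, ih, hinv]
    · have : (fun x : Fin (n + 2) → X => x j.castSucc) = (fun x => x j) ∘ Fin.init := rfl
      rw [this, ← Measure.map_map (measurable_pi_apply _) measurable_init, map_init_markovLaw hQ,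
        ih]

theorem map_last_pair_markovLaw (hQ : IsTransKernel Q) [IsProbabilityMeasure μ]
    (hinv : μ.bind Q = μ) (n : ℕ) :
    (markovLaw μ Q (n + 1)).map (fun x => (x (Fin.last n).castSucc, x (Fin.last (n + 1)))) =
      μ.compProd hQ.toKernel := by
  have := hQ.isMarkovKernel
  ext s hs
  have hm : Measurable fun x : Fin (n + 2) → X =>
      (x (Fin.last n).castSucc, x (Fin.last (n + 1))) :=
    (measurable_pi_apply _).prodMk (measurable_pi_apply _)
  rw [Measure.map_apply hm hs, markovLaw_succ_apply hQ (hm hs), Measure.compProd_apply hs]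
  conv_rhs => rw [← map_eval_markovLaw hQ hinv (Fin.last n)]
  rw [lintegral_map (ProbabilityTheory.Kernel.measurable_kernel_prodMk_left hs)
    (measurable_pi_apply _)]
  refine lintegral_congr fun x => ?_
  simp only [mem_preimage, Fin.snoc_last, Fin.snoc_castSucc]
  rfl

theorem map_pair_markovLaw (hQ : IsTransKernel Q) [IsProbabilityMeasure μ]
    (hinv : μ.bind Q = μ) {n : ℕ} (i : Fin n) :
    (markovLaw μ Q n).map (fun x => (x i.castSucc, x i.succ)) = μ.compProd hQ.toKernel := by
  induction n with
  | zero => exact i.elim0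
  | succ n ih =>
    refine Fin.lastCases ?_ (fun j => ?_) i
    · simpa only [Fin.succ_last] using map_last_pair_markovLaw hQ hinv n
    · have : (fun x : Fin (n + 2) → X => (x j.castSucc.castSucc, x j.castSucc.succ)) =
          (fun x => (x j.castSucc, x j.succ)) ∘ Fin.init := rfl
      rw [this, ← Measure.map_map ((measurable_pi_apply _).prodMk (measurable_pi_apply _))
        measurable_init, map_init_markovLaw hQ, ih]

theorem ae_compProd_mem_graph2 {T : X → Set X} (hQ : IsTransKernel Q) [IsProbabilityMeasure μ]
    (hT : MeasurableSet (graph2 T)) (hTQ : SupportedBy T Q) :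
    ∀ᵐ p ∂μ.compProd hQ.toKernel, p ∈ graph2 T := by
  have := hQ.isMarkovKernel
  rw [ae_iff, Measure.compProd_apply (show MeasurableSet {p | p ∉ graph2 T} from hT.compl),
    lintegral_eq_zero_iff (ProbabilityTheory.Kernel.measurable_kernel_prodMk_left
      (show MeasurableSet {p | p ∉ graph2 T} from hT.compl))]
  refine Eventually.of_forall fun x => ?_
  have := hQ.2 x
  have hm : MeasurableSet (T x) := measurable_prodMk_left (x := x) hT
  exact (prob_compl_eq_zero_iff hm).2 (hTQ x)

theorem ae_markovLaw_isFinOrbit {T : X → Set X} (hQ : IsTransKernel Q) [IsProbabilityMeasure μ]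
    (hinv : μ.bind Q = μ) (hT : MeasurableSet (graph2 T)) (hTQ : SupportedBy T Q) (n : ℕ) :
    ∀ᵐ x ∂markovLaw μ Q n, IsFinOrbit T x := by
  refine ae_all_iff.2 fun i => ?_
  have h := ae_compProd_mem_graph2 (μ := μ) hQ hT hTQ
  rw [← map_pair_markovLaw hQ hinv i] at h
  exact ae_of_ae_map ((measurable_pi_apply _).prodMk (measurable_pi_apply _)).aemeasurable h

theorem integral_markovLaw_eval (hQ : IsTransKernel Q) (hinv : μ.bind Q = μ) {g : X → ℝ}
    (hg : Measurable g) {n : ℕ} (i : Fin (n + 1)) :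
    ∫ x, g (x i) ∂markovLaw μ Q n = ∫ x, g x ∂μ := by
  conv_rhs => rw [← map_eval_markovLaw hQ hinv i]
  rw [integral_map (measurable_pi_apply _).aemeasurable hg.aestronglyMeasurable]

theorem integral_markovLaw_pair (hQ : IsTransKernel Q) [IsProbabilityMeasure μ]
    (hinv : μ.bind Q = μ) {ψ : X × X → ℝ} (hψ : Measurable ψ) {n : ℕ} (i : Fin n) :
    ∫ x, ψ (x i.castSucc, x i.succ) ∂markovLaw μ Q n = ∫ p, ψ p ∂μ.compProd hQ.toKernel := by
  rw [← map_pair_markovLaw hQ hinv i, integral_map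
    ((measurable_pi_apply _).prodMk (measurable_pi_apply _)).aemeasurable hψ.aestronglyMeasurable]

end MarkovLaw

/-! ### An upper bound for the entropy of a kernel -/

theorem exists_continuous_log_approx {X : Type*} [MetricSpace X] [CompactSpace X]
    [MeasurableSpace X] [BorelSpace X] {μ : Measure X} [IsProbabilityMeasure μ] {m : ℕ}
    {p : X → Fin m} (hp : Measurable p) {ε : ℝ} (hε : 0 < ε) :
    ∃ g : Fin m → X → ℝ, (∀ i, Continuous (g i)) ∧ (∀ x, ∑ i, Real.exp (g i x) ≤ 1) ∧
      -ε ≤ ∫ x, g (p x) x ∂μ := by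
  have hX : Nonempty X := nonempty_of_isProbabilityMeasure μ
  obtain ⟨x₀⟩ := hX
  have hm : (0 : ℝ) < m := by exact_mod_cast (p x₀).pos
  obtain ⟨e, he, hme⟩ : ∃ e : ℝ, 0 < e ∧ m * e = ε / 2 :=
    ⟨ε / (2 * m), by positivity, by field_simp⟩
  have hA : ∀ j, MeasurableSet (p ⁻¹' {j}) := fun j => hp (measurableSet_singleton j)
  have hδ : 0 < e * ε / (2 * m) := by positivity
  have happ : ∀ j : Fin m, ∃ χ : BoundedContinuousFunction X ℝ,
      ∫ x, ‖(p ⁻¹' {j}).indicator (fun _ => (1 : ℝ)) x - χ x‖ ∂μ ≤ e * ε / (2 * m) ∧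
        Integrable χ μ := fun j =>
    Integrable.exists_boundedContinuous_integral_sub_le
      ((integrable_const (1 : ℝ)).indicator (hA j)) hδ
  choose χ hχ hχi using happ
  set D : X → ℝ := fun x => ∑ j, ‖(p ⁻¹' {j}).indicator (fun _ => (1 : ℝ)) x - χ j x‖ with hD
  have hDint : ∀ j, Integrable
      (fun x => ‖(p ⁻¹' {j}).indicator (fun _ => (1 : ℝ)) x - χ j x‖) μ := fun j =>
    (((integrable_const (1 : ℝ)).indicator (hA j)).sub (hχi j)).norm
  have hDi : Integrable D μ := integrable_finsetSum _ fun j _ => hDint j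
  have hD0 : ∀ x, 0 ≤ D x := fun x => Finset.sum_nonneg fun j _ => norm_nonneg _
  have hDle : ∫ x, D x ∂μ ≤ e * (ε / 2) := by
    rw [hD, integral_finsetSum _ fun j _ => hDint j]
    refine (Finset.sum_le_sum fun j _ => hχ j).trans ?_
    rw [Finset.sum_const, Finset.card_univ, Fintype.card_fin, nsmul_eq_mul]
    field_simp
    exact le_rfl
  set S : X → ℝ := fun x => ∑ j, |χ j x| with hS
  have hSc : Continuous S := continuous_finsetSum _ fun j _ => (χ j).continuous.abs
  set N : X → ℝ := fun x => max 1 (S x) with hN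
  have hN1 : ∀ x, 1 ≤ N x := fun x => le_max_left _ _
  have hN0 : ∀ x, 0 < N x := fun x => one_pos.trans_le (hN1 x)
  set κ : Fin m → X → ℝ := fun i x => (|χ i x| / N x + e) / (1 + m * e) with hκ
  have hκ0 : ∀ i x, 0 < κ i x := fun i x => by
    have := hN0 x
    positivity
  have hκ1 : ∀ x, ∑ i, κ i x ≤ 1 := fun x => by
    rw [hκ]
    simp only
    rw [← Finset.sum_div, div_le_one (by positivity), Finset.sum_add_distrib, ← Finset.sum_div,
      Finset.sum_const, Finset.card_univ, Fintype.card_fin, nsmul_eq_mul]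
    gcongr
    rw [div_le_one (hN0 x)]
    exact le_max_right _ _
  have hexp : ∀ x, ∑ i, Real.exp (Real.log (κ i x)) ≤ 1 := fun x => by
    simpa only [Real.exp_log (hκ0 _ _)] using hκ1 x
  refine ⟨fun i x => Real.log (κ i x), fun i => ?_, hexp, ?_⟩
  · refine Continuous.log ?_ fun x => (hκ0 i x).ne'
    exact ((((χ i).continuous.abs).div (continuous_const.max hSc) fun x => (hN0 x).ne').add
      continuous_const).div_const _
  have hpt : ∀ x, -Real.log (κ (p x) x) ≤ ε / 2 + D x / e := by
    intro x
    have h1 : 1 - |χ (p x) x| / N x ≤ D x := by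
      rcases le_total (S x) 1 with h | h
      · have hNx : N x = 1 := max_eq_left h
        rw [hNx, div_one]
        calc 1 - |χ (p x) x| ≤ |1 - χ (p x) x| := by
              have := abs_sub_abs_le_abs_sub 1 (χ (p x) x)
              rwa [abs_one] at this
          _ = ‖(p ⁻¹' {p x}).indicator (fun _ => (1 : ℝ)) x - χ (p x) x‖ := by
              rw [indicator_of_mem (by simp), Real.norm_eq_abs]
          _ ≤ D x := Finset.single_le_sum
              (f := fun j => ‖(p ⁻¹' {j}).indicator (fun _ => (1 : ℝ)) x - χ j x‖)
              (fun j _ => norm_nonneg _) (Finset.mem_univ _)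
      · have hNx : N x = S x := max_eq_right h
        have hS0 : 0 < S x := one_pos.trans_le h
        have hsub : S x - |χ (p x) x| ≤ D x := by
          rw [hS, hD]
          simp only
          rw [← Finset.sum_erase_add _ _ (Finset.mem_univ (p x)),
            ← Finset.sum_erase_add _ _ (Finset.mem_univ (p x)), add_sub_cancel_right]
          refine le_add_of_le_of_nonneg (Finset.sum_le_sum fun j hj => ?_) (norm_nonneg _)
          rw [indicator_of_notMem, zero_sub, norm_neg, Real.norm_eq_abs]
          exact fun h => (Finset.ne_of_mem_erase hj) h.symm
        rw [hNx, one_sub_div hS0.ne']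
        refine (div_le_self ?_ h).trans hsub
        exact sub_nonneg.2 (Finset.single_le_sum (f := fun j => |χ j x|)
          (fun j _ => abs_nonneg _) (Finset.mem_univ _))
    have hχ0 : 0 ≤ |χ (p x) x| / N x := div_nonneg (abs_nonneg _) (hN0 x).le
    set s := |χ (p x) x| / N x + e with hs
    have hse : e ≤ s := by linarith
    have hs0 : 0 < s := he.trans_le hse
    have h2 : -Real.log s ≤ D x / e := by
      rw [← Real.log_inv]
      refine (Real.log_le_sub_one_of_pos (inv_pos.2 hs0)).trans ?_
      have : s⁻¹ - 1 = (1 - s) / s := by field_simp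
      rw [this]
      refine (div_le_div_of_nonneg_right (by linarith : 1 - s ≤ D x) hs0.le).trans ?_
      exact div_le_div_of_nonneg_left (hD0 x) he hse
    have h3 : Real.log (1 + m * e) ≤ ε / 2 := by
      have := Real.log_le_sub_one_of_pos (show 0 < 1 + m * e by positivity)
      linarith
    have : Real.log (κ (p x) x) = Real.log s - Real.log (1 + m * e) :=
      Real.log_div hs0.ne' (by positivity)
    linarith
  have hneg : ∫ x, -Real.log (κ (p x) x) ∂μ ≤ ∫ x, (ε / 2 + D x / e) ∂μ := by
    refine integral_mono_of_nonneg (Eventually.of_forall fun x => ?_)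
      ((integrable_const _).add (hDi.div_const e)) (Eventually.of_forall hpt)
    refine neg_nonneg.2 (Real.log_nonpos (hκ0 _ _).le ?_)
    exact (Finset.single_le_sum (f := fun i => κ i x) (fun i _ => (hκ0 i x).le)
      (Finset.mem_univ _)).trans (hκ1 x)
  rw [integral_neg, integral_add (integrable_const _) (hDi.div_const e), integral_const,
    probReal_univ, one_smul, integral_div] at hneg
  have : (∫ x, D x ∂μ) / e ≤ ε / 2 := by
    rw [div_le_iff₀ he, mul_comm]
    exact hDle
  linarith

theorem partEntropy_le {Y I : Type*} [MeasurableSpace Y] {ν : Measure Y} [IsProbabilityMeasure ν]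
    [Fintype I] [MeasurableSpace I] [MeasurableSingletonClass I] {P : Y → I} (hP : Measurable P)
    {W : I → ℝ} (hW : ∀ a, 0 ≤ W a) {Z : ℝ} (hZ : 0 < Z) (hWZ : ∑ a, W a ≤ Z) {h : Y → ℝ}
    (hh : Integrable h ν) (hle : ∀ᵐ y ∂ν, 0 < W (P y) ∧ h y ≤ Real.log (W (P y))) :
    partEntropy ν P ≤ Real.log Z - ∫ y, h y ∂ν := by
  have hPν : IsProbabilityMeasure (ν.map P) := Measure.isProbabilityMeasure_map hP.aemeasurable
  set q : I → ℝ := fun a => (ν (P ⁻¹' {a})).toReal with hq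
  have hqr : ∀ a, (ν.map P).real {a} = q a := fun a => by
    rw [measureReal_def, Measure.map_apply hP (measurableSet_singleton a)]
  have hq1 : ∑ a, q a = 1 := by
    have := integral_fintype (μ := ν.map P) (f := fun _ : I => (1 : ℝ)) Integrable.of_finite
    simpa [hqr] using this.symm
  have hint : ∫ y, h y ∂ν ≤ ∑ a, q a * Real.log (W a) := by
    have h1 : ∫ y, Real.log (W (P y)) ∂ν = ∑ a, q a * Real.log (W a) := by
      have h2 := integral_map (μ := ν) hP.aemeasurable
        (Measurable.of_discrete (f := fun a => Real.log (W a))).aestronglyMeasurable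
      rw [← h2, integral_fintype Integrable.of_finite]
      simp only [hqr, smul_eq_mul]
    rw [← h1]
    refine integral_mono_ae hh ?_ (hle.mono fun y hy => hy.2)
    exact (Integrable.of_finite (μ := ν.map P) (f := fun a => Real.log (W a))).comp_measurable hP
  have hpos : ∀ a, 0 < q a → 0 < W a := by
    intro a ha
    by_contra hWa
    have : ν (P ⁻¹' {a}) = 0 := by
      refine measure_mono_null (fun y hy => ?_) (ae_iff.1 hle)
      rw [mem_preimage, mem_singleton_iff] at hy
      rw [mem_ofPred_eq, hy]
      exact fun h' => hWa h'.1
    simp [hq, this] at ha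
  have hterm : ∀ a, Real.negMulLog (q a) + q a * Real.log (W a) - q a * Real.log Z ≤
      W a / Z - q a := by
    intro a
    have hq0 : 0 ≤ q a := ENNReal.toReal_nonneg
    rcases hq0.eq_or_lt with h0 | h0
    · rw [← h0]
      simpa using div_nonneg (hW a) hZ.le
    · have hWa := hpos a h0
      have h1 := Real.log_le_sub_one_of_pos (show 0 < W a / (Z * q a) by positivity)
      rw [Real.log_div hWa.ne' (by positivity), Real.log_mul hZ.ne' h0.ne'] at h1
      have h2 := mul_le_mul_of_nonneg_left h1 h0.le
      have h3 : q a * (W a / (Z * q a) - 1) = W a / Z - q a := by field_simp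
      rw [h3] at h2
      unfold Real.negMulLog
      linarith
  have hsum := Finset.sum_le_sum fun a (_ : a ∈ Finset.univ) => hterm a
  simp only [Finset.sum_sub_distrib, Finset.sum_add_distrib, ← Finset.sum_mul,
    ← Finset.sum_div, hq1] at hsum
  have hZ1 : (∑ a, W a) / Z ≤ 1 := (div_le_one hZ).2 hWZ
  change ∑ a, Real.negMulLog (q a) ≤ _
  linarith

section EntropyBound

variable {X : Type*} [MetricSpace X] [CompactSpace X] [MeasurableSpace X] [BorelSpace X]
  {T : X → Set X} {μ : Measure X} [IsProbabilityMeasure μ] {Q : X → Measure X} {ψ : X × X → ℝ}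

theorem integrable_comp_diag {m : ℕ} {p : X → Fin m} (hp : Measurable p) {g : Fin m → X → ℝ}
    (hg : ∀ i, Continuous (g i)) : Integrable (fun x => g (p x) x) μ := by
  have hmeas : Measurable fun x => g (p x) x :=
    (measurable_from_prod_countable_right fun i => (hg i).measurable :
      Measurable fun q : Fin m × X => g q.1 q.2).comp (hp.prodMk measurable_id)
  choose b hb0 hb using fun i => exists_abs_bound (hg i)
  refine Integrable.of_bound hmeas.aestronglyMeasurable (∑ i, b i)
    (Eventually.of_forall fun x => ?_)
  exact (hb (p x) x).trans (Finset.single_le_sum (fun i _ => hb0 i) (Finset.mem_univ _))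

/-- The entropy of a finite partition along a Markov chain is controlled by weighted sums over
backward orbits. -/
theorem exists_partEntropy_markovLaw_le (hfin : ∀ x, {y | x ∈ T y}.Finite)
    (hgraph : MeasurableSet (graph2 T)) (hQ : IsTransKernel Q) (hTQ : SupportedBy T Q)
    (hinv : μ.bind Q = μ) (hψ : Measurable ψ) {M : ℝ} (hM : ∀ p, |ψ p| ≤ M)
    (hmatch : ∀ ε > 0, ∃ δ > 0, ∀ x x', dist x x' < δ → ∀ n, ∀ y ∈ backOrbits T n x,
      ∃ y' ∈ backOrbits T n x', (∀ i, dist (y i) (y' i) ≤ ε) ∧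
        |pathSum ψ y - pathSum ψ y'| ≤ (n + 1) * ε)
    {B C : ℝ} (hB : 0 < B) (hC : 0 < C)
    (hgrowth : ∀ n x, (transferOp hfin ψ ^ n) 1 x ≤ C * B ^ n) {m : ℕ} {p : X → Fin m}
    (hp : Measurable p) {ε : ℝ} (hε : 0 < ε) :
    ∃ K : ℝ, ∀ k : ℕ, partEntropy (markovLaw μ Q k) (fun x => p ∘ x) ≤
      K + k * (Real.log B - ∫ q, ψ q ∂μ.compProd hQ.toKernel) + (k + 1) * (3 * ε) := by
  have hX : Nonempty X := nonempty_of_isProbabilityMeasure μ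
  obtain ⟨g, hg, hg1, hgint⟩ := exists_continuous_log_approx (μ := μ) hp hε
  have huc : ∃ ε' > 0, ε' ≤ ε ∧ ∀ i, ∀ x y, dist x y ≤ ε' → |g i x - g i y| ≤ ε := by
    have h1 : ∀ i, ∃ r > 0, ∀ x y, dist x y < r → |g i x - g i y| < ε := fun i => by
      obtain ⟨r, hr, h⟩ := Metric.uniformContinuous_iff.1
        (CompactSpace.uniformContinuous_of_continuous (hg i)) ε hε
      exact ⟨r, hr, fun x y hxy => h hxy⟩
    choose r hr hr' using h1
    obtain ⟨r₀, hr₀, hr₀'⟩ : ∃ r₀ > 0, ∀ i, r₀ ≤ r i := by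
      rcases isEmpty_or_nonempty (Fin m) with h | h
      · exact ⟨1, one_pos, fun i => isEmptyElim i⟩
      · refine ⟨Finset.univ.inf' Finset.univ_nonempty r, ?_, fun i =>
          Finset.inf'_le _ (Finset.mem_univ i)⟩
        exact (Finset.lt_inf'_iff _).2 fun i _ => hr i
    refine ⟨min ε (r₀ / 2), lt_min hε (half_pos hr₀), min_le_left _ _, fun i x y hxy => ?_⟩
    refine (hr' i x y (lt_of_le_of_lt hxy ?_)).le
    exact (min_le_right _ _).trans_lt ((half_lt_self hr₀).trans_le (hr₀' i))
  obtain ⟨ε', hε', hεε', huc⟩ := huc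
  obtain ⟨δ, hδ, hδ'⟩ := hmatch ε' hε'
  obtain ⟨F, -, hFfin, hF⟩ := finite_cover_balls_of_compact (isCompact_univ (X := X)) hδ
  lift F to Finset X using hFfin
  have hFne : 0 < (F.card : ℝ) := by
    obtain ⟨x₀⟩ := hX
    obtain ⟨z, hz, -⟩ := mem_iUnion₂.1 (hF (mem_univ x₀))
    exact_mod_cast Finset.card_pos.2 ⟨z, hz⟩
  refine ⟨Real.log (F.card * C), fun k => ?_⟩
  have hprob := isProbabilityMeasure_markovLaw (μ := μ) hQ k
  set W : (Fin (k + 1) → Fin m) → ℝ := fun a =>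
    ∑ z ∈ F, ∑ y ∈ (backOrbits_finite hfin k z).toFinset,
      Real.exp (pathSum ψ y + ∑ j, g (a j) (y j)) with hW
  have hWnn : ∀ a, 0 ≤ W a := fun a =>
    Finset.sum_nonneg fun z _ => Finset.sum_nonneg fun y _ => (Real.exp_pos _).le
  have hWsum : ∑ a, W a ≤ F.card * C * B ^ k := by
    calc ∑ a, W a = ∑ z ∈ F, ∑ y ∈ (backOrbits_finite hfin k z).toFinset,
          Real.exp (pathSum ψ y) * ∏ j, ∑ i, Real.exp (g i (y j)) := by
          rw [hW, Finset.sum_comm]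
          refine Finset.sum_congr rfl fun z _ => ?_
          rw [Finset.sum_comm]
          refine Finset.sum_congr rfl fun y _ => ?_
          rw [Finset.prod_univ_sum, Fintype.piFinset_univ, Finset.mul_sum]
          refine Finset.sum_congr rfl fun a _ => ?_
          rw [Real.exp_add, Real.exp_sum]
      _ ≤ ∑ z ∈ F, (transferOp hfin ψ ^ k) 1 z := by
          refine Finset.sum_le_sum fun z _ => ?_
          rw [transferOp_pow_apply]
          refine Finset.sum_le_sum fun y _ => ?_
          refine mul_le_mul_of_nonneg_left ?_ (Real.exp_pos _).le
          exact Finset.prod_le_one (fun j _ => Finset.sum_nonneg fun i _ => (Real.exp_pos _).le)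
            fun j _ => hg1 _
      _ ≤ ∑ z ∈ F, C * B ^ k := Finset.sum_le_sum fun z _ => hgrowth k z
      _ = F.card * C * B ^ k := by rw [Finset.sum_const, nsmul_eq_mul, mul_assoc]
  set h : (Fin (k + 1) → X) → ℝ := fun x =>
    pathSum ψ x + ∑ j, g (p (x j)) (x j) - (k + 1) * (2 * ε) with hh
  have hψpair : ∀ i : Fin k, Integrable (fun x : Fin (k + 1) → X => ψ (x i.castSucc, x i.succ))
      (markovLaw μ Q k) := fun i =>
    Integrable.of_bound (hψ.comp ((measurable_pi_apply _).prodMk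
      (measurable_pi_apply _))).aestronglyMeasurable M (Eventually.of_forall fun x => hM _)
  have hdiag := integrable_comp_diag (μ := μ) hp hg
  have hdiagm : Measurable fun x => g (p x) x :=
    (measurable_from_prod_countable_right fun i => (hg i).measurable :
      Measurable fun q : Fin m × X => g q.1 q.2).comp (hp.prodMk measurable_id)
  have hgj : ∀ j : Fin (k + 1), Integrable (fun x : Fin (k + 1) → X => g (p (x j)) (x j))
      (markovLaw μ Q k) := fun j => by
    rw [← map_eval_markovLaw hQ hinv j] at hdiag
    exact hdiag.comp_measurable (measurable_pi_apply j)
  have hi1 : Integrable (fun x : Fin (k + 1) → X => pathSum ψ x) (markovLaw μ Q k) :=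
    integrable_finsetSum _ fun i _ => hψpair i
  have hi2 : Integrable (fun x : Fin (k + 1) → X => ∑ j, g (p (x j)) (x j)) (markovLaw μ Q k) :=
    integrable_finsetSum _ fun j _ => hgj j
  have hi12 : Integrable (fun x : Fin (k + 1) → X => pathSum ψ x + ∑ j, g (p (x j)) (x j))
      (markovLaw μ Q k) := hi1.add hi2
  have hhi : Integrable h (markovLaw μ Q k) := hi12.sub (integrable_const _)
  have hhint : k * (∫ q, ψ q ∂μ.compProd hQ.toKernel) - (k + 1) * (3 * ε) ≤
      ∫ x, h x ∂markovLaw μ Q k := by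
    have e1 : ∫ x, pathSum ψ x ∂markovLaw μ Q k = k * ∫ q, ψ q ∂μ.compProd hQ.toKernel := by
      unfold pathSum
      rw [integral_finsetSum _ fun i _ => hψpair i]
      simp only [integral_markovLaw_pair hQ hinv hψ]
      simp
    have e2 : ∫ x, ∑ j, g (p (x j)) (x j) ∂markovLaw μ Q k =
        (k + 1) * ∫ x, g (p x) x ∂μ := by
      rw [integral_finsetSum _ fun j _ => hgj j]
      simp only [integral_markovLaw_eval hQ hinv hdiagm]
      simp
    have e3 : ∫ x, h x ∂markovLaw μ Q k = k * (∫ q, ψ q ∂μ.compProd hQ.toKernel) +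
        (k + 1) * (∫ x, g (p x) x ∂μ) - (k + 1) * (2 * ε) := by
      simp only [hh]
      rw [integral_sub hi12 (integrable_const _), integral_add hi1 hi2, e1, e2,
        integral_const, probReal_univ, one_smul]
    rw [e3]
    have : ((k : ℝ) + 1) * (-ε) ≤ (k + 1) * ∫ x, g (p x) x ∂μ :=
      mul_le_mul_of_nonneg_left hgint (by positivity)
    linarith
  have hP : Measurable fun x : Fin (k + 1) → X => p ∘ x :=
    measurable_pi_iff.2 fun j => hp.comp (measurable_pi_apply j)
  have hle : ∀ᵐ x ∂markovLaw μ Q k, 0 < W (p ∘ x) ∧ h x ≤ Real.log (W (p ∘ x)) := by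
    filter_upwards [ae_markovLaw_isFinOrbit hQ hinv hgraph hTQ k] with x hx
    obtain ⟨z, hzF, hz⟩ := mem_iUnion₂.1 (hF (mem_univ (x (Fin.last k))))
    obtain ⟨y, hy, hdist, hsum⟩ := hδ' _ z hz k x ⟨hx, rfl⟩
    have hterm : Real.exp (pathSum ψ y + ∑ j, g (p (x j)) (y j)) ≤ W (p ∘ x) :=
      (Finset.single_le_sum (f := fun y => Real.exp (pathSum ψ y + ∑ j, g (p (x j)) (y j)))
        (fun y _ => (Real.exp_pos _).le) ((backOrbits_finite hfin k z).mem_toFinset.2 hy)).trans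
        (Finset.single_le_sum (f := fun z => ∑ y ∈ (backOrbits_finite hfin k z).toFinset,
          Real.exp (pathSum ψ y + ∑ j, g (p (x j)) (y j)))
          (fun z _ => Finset.sum_nonneg fun y _ => (Real.exp_pos _).le) hzF)
    have hpos : 0 < W (p ∘ x) := (Real.exp_pos _).trans_le hterm
    refine ⟨hpos, ?_⟩
    rw [Real.le_log_iff_exp_le hpos]
    refine le_trans (Real.exp_le_exp.2 ?_) hterm
    have hgs : ∑ j, g (p (x j)) (x j) - ∑ j, g (p (x j)) (y j) ≤ (k + 1) * ε := by
      rw [← Finset.sum_sub_distrib]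
      refine (Finset.sum_le_sum fun j _ =>
        (le_abs_self _).trans (huc (p (x j)) _ _ (hdist j))).trans (le_of_eq ?_)
      simp
    have h2 := (le_abs_self _).trans hsum
    have h3 : ((k : ℝ) + 1) * ε' ≤ (k + 1) * ε := by gcongr
    rw [hh]
    simp only
    linarith
  have hmain := partEntropy_le hP hWnn (by positivity) hWsum hhi hle
  have hlog : Real.log (F.card * C * B ^ k) = Real.log (F.card * C) + k * Real.log B := by
    rw [Real.log_mul (by positivity) (by positivity), Real.log_pow]
  rw [hlog] at hmain
  linarith

theorem partEntropy_nonneg {Y I : Type*} [MeasurableSpace Y] {ν : Measure Y}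
    [IsProbabilityMeasure ν] [Fintype I] (P : Y → I) : 0 ≤ partEntropy ν P :=
  Finset.sum_nonneg fun _ _ => Real.negMulLog_nonneg ENNReal.toReal_nonneg
    (ENNReal.toReal_le_of_le_ofReal zero_le_one (by simpa using prob_le_one))

theorem kernelEntropy_le (hfin : ∀ x, {y | x ∈ T y}.Finite)
    (hgraph : MeasurableSet (graph2 T)) (hQ : IsTransKernel Q) (hTQ : SupportedBy T Q)
    (hinv : μ.bind Q = μ) (hψ : Measurable ψ) {M : ℝ} (hM : ∀ p, |ψ p| ≤ M)
    (hmatch : ∀ ε > 0, ∃ δ > 0, ∀ x x', dist x x' < δ → ∀ n, ∀ y ∈ backOrbits T n x,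
      ∃ y' ∈ backOrbits T n x', (∀ i, dist (y i) (y' i) ≤ ε) ∧
        |pathSum ψ y - pathSum ψ y'| ≤ (n + 1) * ε)
    {B C : ℝ} (hB : 0 < B) (hC : 0 < C)
    (hgrowth : ∀ n x, (transferOp hfin ψ ^ n) 1 x ≤ C * B ^ n) :
    kernelEntropy μ Q ≤
      ((Real.log B - ∫ q, ψ q ∂μ.compProd hQ.toKernel : ℝ) : EReal) := by
  refine iSup_le fun m => iSup_le fun p => iSup_le fun hp => EReal.coe_le_coe_iff.2 ?_
  set β := Real.log B - ∫ q, ψ q ∂μ.compProd hQ.toKernel with hβ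
  refine le_of_forall_pos_le_add fun ε hε => ?_
  obtain ⟨K, hK⟩ := exists_partEntropy_markovLaw_le hfin hgraph hQ hTQ hinv hψ hM hmatch hB hC
    hgrowth hp (show 0 < ε / 6 by positivity)
  have hlim : Tendsto (fun n : ℕ => (K - β) * (n : ℝ)⁻¹ + (β + ε / 2)) atTop
      (𝓝 ((K - β) * 0 + (β + ε / 2))) :=
    (tendsto_inv_atTop_nhds_zero_nat.const_mul _).add_const _
  have hev := hlim.eventually_lt_const (show (K - β) * 0 + (β + ε / 2) < β + ε by linarith)
  refine limsup_le_of_le ?_ ?_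
  · refine IsCoboundedUnder.of_frequently_ge (a := 0) (Eventually.frequently ?_)
    refine Eventually.of_forall fun n => ?_
    have := isProbabilityMeasure_markovLaw (μ := μ) hQ (n - 1)
    exact mul_nonneg (by positivity) (partEntropy_nonneg _)
  · filter_upwards [hev, eventually_gt_atTop 0] with n hn hn0
    obtain ⟨k, rfl⟩ : ∃ k, n = k + 1 := ⟨n - 1, by omega⟩
    refine le_trans ?_ hn.le
    have hk := hK k
    have hn1 : (0 : ℝ) < ((k + 1 : ℕ) : ℝ) := by positivity
    have h2 := mul_le_mul_of_nonneg_left hk (inv_pos.2 hn1).le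
    refine (h2.trans (le_of_eq ?_))
    push_cast at hn1 ⊢
    field_simp
    ring

end EntropyBound

/-! ### Equilibrium states and backward time averages -/

/-- Matching of backward orbits for a tilted potential. -/
theorem exists_backOrbit_matching_tilt {X : Type*} [MetricSpace X] [CompactSpace X]
    {T : X → Set X} {φ : ↥(graph2 T) → ℝ} (hT : IsCorrespondence T)
    (hopen : IsOpenCorr T) (htrans : StronglyTransitive T) (hdexp : DistanceExpanding T)
    (hφ : HolderOn T φ) {f : X → ℝ} (hf : Continuous f) (t : ℝ) {ε : ℝ} (hε : 0 < ε) :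
    ∃ δ > 0, ∀ x x', dist x x' < δ → ∀ n, ∀ y ∈ backOrbits T n x,
      ∃ y' ∈ backOrbits T n x', (∀ i, dist (y i) (y' i) ≤ ε) ∧
        |pathSum (fun p => ext2 T φ p + t * f p.1) y -
          pathSum (fun p => ext2 T φ p + t * f p.1) y'| ≤ (n + 1) * ε := by
  obtain ⟨r, hr, hfr⟩ := Metric.uniformContinuous_iff.1
    (CompactSpace.uniformContinuous_of_continuous hf) (ε / (|t| + 1)) (by positivity)
  obtain ⟨δ, hδ, h⟩ := exists_backOrbit_matching hT hopen htrans hdexp hφ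
    (lt_min hε (half_pos hr))
  refine ⟨δ, hδ, fun x x' hxx' n y hy => ?_⟩
  obtain ⟨y', hy', hd, hs⟩ := h x x' hxx' n y hy
  refine ⟨y', hy', fun i => (hd i).trans (min_le_left _ _), ?_⟩
  have hterm : ∀ i, |t * f (y i) - t * f (y' i)| ≤ ε := fun i => by
    have h1 : |f (y i) - f (y' i)| < ε / (|t| + 1) :=
      hfr (((hd i).trans (min_le_right _ _)).trans_lt (half_lt_self hr))
    rw [← mul_sub, abs_mul]
    calc |t| * |f (y i) - f (y' i)| ≤ (|t| + 1) * (ε / (|t| + 1)) := by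
          gcongr
          linarith
      _ = ε := by field_simp
  have hsplit : ∀ z : Fin (n + 1) → X, pathSum (fun p => ext2 T φ p + t * f p.1) z =
      pathSum (ext2 T φ) z + ∑ i : Fin n, t * f (z i.castSucc) := fun z =>
    Finset.sum_add_distrib
  rw [hsplit, hsplit]
  have hsum : |∑ i : Fin n, (t * f (y i.castSucc) - t * f (y' i.castSucc))| ≤ n * ε := by
    refine (Finset.abs_sum_le_sum_abs _ _).trans
      ((Finset.sum_le_sum fun i _ => hterm i.castSucc).trans (le_of_eq ?_))
    simp
  rw [Finset.sum_sub_distrib] at hsum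
  have hs' := hs.trans (min_le_left _ _)
  have := abs_add_le (pathSum (ext2 T φ) y - pathSum (ext2 T φ) y')
    (∑ i : Fin n, t * f (y i.castSucc) - ∑ i : Fin n, t * f (y' i.castSucc))
  rw [add_sub_add_comm]
  linarith

section Equilibrium

variable {X : Type*} [MetricSpace X] [CompactSpace X] [MeasurableSpace X] [BorelSpace X]
  {T : X → Set X} {φ : ↥(graph2 T) → ℝ} {μ : Measure X} {Q : X → Measure X}

theorem IsCorrespondence.measurableSet_graph2 (hT : IsCorrespondence T) :
    MeasurableSet (graph2 T) := hT.2.2.measurableSet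

theorem measurable_ext2 (hT : IsCorrespondence T) (hφ : HolderOn T φ) :
    Measurable (ext2 T φ) := by
  have h : (graph2 T).piecewise (ext2 T φ) 0 = ext2 T φ := by
    ext p
    by_cases hp : p ∈ graph2 T <;> simp [hp, ext2]
  rw [← h]
  exact hφ.continuousOn_ext2.measurable_piecewise continuousOn_const hT.measurableSet_graph2

theorem integrable_ext2 (hT : IsCorrespondence T) (hφ : HolderOn T φ) {ρ : Measure (X × X)}
    [IsFiniteMeasure ρ] : Integrable (ext2 T φ) ρ := by
  obtain ⟨M, -, hM⟩ := exists_abs_ext2_le hT hφ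
  exact Integrable.of_bound (measurable_ext2 hT hφ).aestronglyMeasurable M
    (Eventually.of_forall hM)

theorem energyInt_eq_integral_compProd [IsProbabilityMeasure μ] (hT : IsCorrespondence T)
    (hφ : HolderOn T φ) (hQ : IsTransKernel Q) :
    energyInt T φ Q μ = ∫ p, ext2 T φ p ∂μ.compProd hQ.toKernel := by
  have := hQ.isMarkovKernel
  rw [Measure.integral_compProd (integrable_ext2 hT hφ)]
  refine integral_congr_ae (Eventually.of_forall fun x => ?_)
  refine setIntegral_eq_integral_of_forall_compl_eq_zero fun y hy => ?_
  exact dif_neg hy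

theorem integrable_comp_fst {f : X → ℝ} (hf : Continuous f) {ρ : Measure (X × X)}
    [IsFiniteMeasure ρ] : Integrable (fun p : X × X => f p.1) ρ := by
  obtain ⟨b, -, hb⟩ := exists_abs_bound hf
  exact Integrable.of_bound (hf.measurable.comp measurable_fst).aestronglyMeasurable b
    (Eventually.of_forall fun p => hb p.1)

theorem integral_comp_fst_compProd [IsProbabilityMeasure μ] (hQ : IsTransKernel Q) {f : X → ℝ}
    (hf : Continuous f) : ∫ p, f p.1 ∂μ.compProd hQ.toKernel = ∫ x, f x ∂μ := by
  have := hQ.isMarkovKernel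
  rw [Measure.integral_compProd (integrable_comp_fst hf)]
  simp

/-- The mean of an observable against an equilibrium state is controlled by the growth of the
tilted transfer operator. -/
theorem IsEquilibrium.mul_integral_le (hμ : IsEquilibrium T φ μ Q) (hT : IsCorrespondence T)
    (hopen : IsOpenCorr T) (htrans : StronglyTransitive T) (hdexp : DistanceExpanding T)
    (hφ : HolderOn T φ) (hfin : ∀ x, {y | x ∈ T y}.Finite) {r : ℝ}
    (hr : (r : EReal) ≤ pressure T φ) {f : X → ℝ} (hf : Continuous f) {t B C : ℝ} (hB : 0 < B)
    (hC : 0 < C)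
    (hgrowth : ∀ n x, (transferOp hfin (fun p => ext2 T φ p + t * f p.1) ^ n) 1 x ≤ C * B ^ n) :
    t * ∫ x, f x ∂μ ≤ Real.log B - r := by
  obtain ⟨hQ, hTQ, hprob, hinv, hP⟩ := hμ
  have hmk := hQ.isMarkovKernel
  obtain ⟨M, -, hM⟩ := exists_abs_ext2_le hT hφ
  obtain ⟨b, -, hb⟩ := exists_abs_bound hf
  have hψ : Measurable fun p : X × X => ext2 T φ p + t * f p.1 :=
    (measurable_ext2 hT hφ).add ((hf.measurable.comp measurable_fst).const_mul t)
  have hψM : ∀ p : X × X, |ext2 T φ p + t * f p.1| ≤ M + |t| * b := fun p => by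
    refine (abs_add_le _ _).trans (add_le_add (hM p) ?_)
    rw [abs_mul]
    exact mul_le_mul_of_nonneg_left (hb p.1) (abs_nonneg t)
  have hent := kernelEntropy_le hfin hT.measurableSet_graph2 hQ hTQ hinv hψ hψM
    (fun ε hε => exists_backOrbit_matching_tilt hT hopen htrans hdexp hφ hf t hε) hB hC hgrowth
  have hfi : Integrable (fun p : X × X => t * f p.1) (μ.compProd hQ.toKernel) :=
    (integrable_comp_fst hf).const_mul t
  rw [integral_add (integrable_ext2 hT hφ) hfi, integral_const_mul,
    integral_comp_fst_compProd hQ hf] at hent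
  have h1 : (r : EReal) ≤ ((Real.log B - ((∫ p, ext2 T φ p ∂μ.compProd hQ.toKernel) +
      t * ∫ x, f x ∂μ) : ℝ) : EReal) + ((energyInt T φ Q μ : ℝ) : EReal) :=
    (hr.trans hP.le).trans (add_le_add_left hent _)
  rw [energyInt_eq_integral_compProd hT hφ hQ, ← EReal.coe_add, EReal.coe_le_coe_iff] at h1
  linarith

end Equilibrium

section BackwardAverages

variable {X : Type*} {T : X → Set X}

/-- Jensen's inequality for weighted averages over backward orbits. -/
theorem exp_mul_backward_average_le (hfin : ∀ x, {y | x ∈ T y}.Finite) (ψ : X × X → ℝ)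
    (f : X → ℝ) (t : ℝ) (n : ℕ) (x : X) (hpos : 0 < (transferOp hfin ψ ^ n) 1 x) :
    Real.exp (t * (n + 1) * ((∑ y ∈ (backOrbits_finite hfin n x).toFinset,
        Real.exp (pathSum ψ y) * ((∑ j, f (y j)) / (n + 1))) / (transferOp hfin ψ ^ n) 1 x)) ≤
      Real.exp (t * f x) * (transferOp hfin (fun p => ψ p + t * f p.1) ^ n) 1 x /
        (transferOp hfin ψ ^ n) 1 x := by
  set Z := (transferOp hfin ψ ^ n) 1 x with hZ
  set s := (backOrbits_finite hfin n x).toFinset with hs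
  have hZsum : Z = ∑ y ∈ s, Real.exp (pathSum ψ y) := transferOp_pow_one_apply hfin ψ n x
  have hJ := convexOn_exp.map_sum_le (t := s) (w := fun y => Real.exp (pathSum ψ y) / Z)
    (p := fun y => t * ∑ j, f (y j)) (fun y _ => div_nonneg (Real.exp_pos _).le hpos.le)
    (by rw [← Finset.sum_div, ← hZsum, div_self hpos.ne']) fun _ _ => mem_univ _
  have h1 : ∑ y ∈ s, (Real.exp (pathSum ψ y) / Z) • (t * ∑ j, f (y j)) =
      t * (n + 1) * ((∑ y ∈ s, Real.exp (pathSum ψ y) * ((∑ j, f (y j)) / (n + 1))) / Z) := by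
    rw [Finset.sum_div, Finset.mul_sum]
    refine Finset.sum_congr rfl fun y _ => ?_
    rw [smul_eq_mul]
    field_simp
  have h2 : ∑ y ∈ s, (Real.exp (pathSum ψ y) / Z) • Real.exp (t * ∑ j, f (y j)) =
      Real.exp (t * f x) * (transferOp hfin (fun p => ψ p + t * f p.1) ^ n) 1 x / Z := by
    rw [transferOp_pow_one_apply, Finset.mul_sum, Finset.sum_div]
    refine Finset.sum_congr rfl fun y hy => ?_
    have hy' : y (Fin.last n) = x := ((backOrbits_finite hfin n x).mem_toFinset.1 hy).2
    rw [smul_eq_mul, pathSum_tilt, hy', div_mul_eq_mul_div, ← Real.exp_add, ← Real.exp_add]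
    congr 2
    ring
  rw [h1, h2] at hJ
  exact hJ

end BackwardAverages

section TimeAverages

variable {X : Type*} [MetricSpace X] [CompactSpace X] [MeasurableSpace X] [BorelSpace X]
  {T : X → Set X} {φ : ↥(graph2 T) → ℝ} {μ : Measure X} {Q : X → Measure X}

theorem IsEquilibrium.tendsto_backward_average (hμ : IsEquilibrium T φ μ Q)
    (hT : IsCorrespondence T) (hopen : IsOpenCorr T) (htrans : StronglyTransitive T)
    (hdexp : DistanceExpanding T) (hφ : HolderOn T φ) (hfin : ∀ x, {y | x ∈ T y}.Finite) (x : X)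
    {f : X → ℝ} (hf : Continuous f) :
    Tendsto (fun n : ℕ => (∑ y ∈ (backOrbits_finite hfin n x).toFinset,
        Real.exp (pathSum (ext2 T φ) y) * ((∑ j, f (y j)) / (n + 1))) /
          (transferOp hfin (ext2 T φ) ^ n) 1 x) atTop (𝓝 (∫ a, f a ∂μ)) := by
  have hne : Nonempty X := ⟨x⟩
  obtain ⟨η, hη, hsep⟩ := hdexp.exists_separation hT.1
  set L := transferOp hfin (ext2 T φ) with hL
  have hLop : IsTransferOp L := isTransferOp_transferOp hT hopen htrans hdexp hφ hfin
  obtain ⟨Λ, hΛ, c₀, hc₀, hgr⟩ := hLop.exists_growth_rate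
  have hpress := log_le_pressure (φ := φ) hη hsep hfin hΛ hc₀ x fun n => (hgr n x).1
  have hscale : ∀ (K : Module.End ℝ (X → ℝ)) (n : ℕ) (z : X),
      ((Λ⁻¹ • K) ^ n) 1 z = (K ^ n) 1 z / Λ ^ n := fun K n z => by
    rw [smul_pow, LinearMap.smul_apply, Pi.smul_apply, smul_eq_mul, inv_pow, div_eq_inv_mul]
  set A : ℕ → ℝ := fun n => (∑ y ∈ (backOrbits_finite hfin n x).toFinset,
        Real.exp (pathSum (ext2 T φ) y) * ((∑ j, f (y j)) / (n + 1))) / (L ^ n) 1 x with hA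
  change Tendsto A atTop _
  rw [Metric.tendsto_nhds]
  intro ε' hε'
  obtain ⟨ε, hε, hεε'⟩ : ∃ ε > 0, 3 * ε < ε' := ⟨ε' / 4, by positivity, by linarith⟩
  obtain ⟨c, τ, hτ, htilt⟩ := (hLop.smul (inv_pos.2 hΛ)).exists_tilted_growth hc₀
    (fun n z => by
      rw [hscale, mul_div_assoc', div_le_one (by positivity)]
      exact (hgr n z).2)
    (fun n z => by
      rw [hscale, le_div_iff₀ (by positivity)]
      exact (hgr n z).1) hf hε
  have hgrowth : ∀ t, |t| = τ → ∃ C, 0 < C ∧ ∀ n z,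
      (transferOp hfin (fun p => ext2 T φ p + t * f p.1) ^ n) 1 z ≤
        C * (Λ * Real.exp (t * c + ε * τ)) ^ n := fun t ht => by
    obtain ⟨C, hC, h⟩ := htilt t ht
      (Λ⁻¹ • transferOp hfin (fun p => ext2 T φ p + t * f p.1)) fun F => by
        rw [LinearMap.smul_apply, LinearMap.smul_apply, transferOp_tilt]
    refine ⟨C, hC, fun n z => ?_⟩
    have := h n z
    rw [hscale, div_le_iff₀ (by positivity)] at this
    rw [mul_pow]
    linarith
  have hmean : ∀ t, |t| = τ → t * ∫ a, f a ∂μ ≤ t * c + ε * τ := fun t ht => by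
    obtain ⟨C, hC, h⟩ := hgrowth t ht
    have := hμ.mul_integral_le hT hopen htrans hdexp hφ hfin hpress hf (by positivity) hC h
    rw [Real.log_mul hΛ.ne' (Real.exp_pos _).ne', Real.log_exp] at this
    linarith
  have havg : ∀ t, |t| = τ → ∀ᶠ n in atTop, t * A n ≤ t * c + 2 * ε * τ := fun t ht => by
    obtain ⟨C, hC, h⟩ := hgrowth t ht
    set β := t * c + ε * τ with hβ
    set K := Real.exp (t * f x) * C / c₀ with hK
    have hK0 : 0 < K := by positivity
    have hn : ∀ n : ℕ, t * (n + 1) * A n ≤ Real.log K + n * β := fun n => by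
      have hZ : 0 < (L ^ n) 1 x :=
        (by positivity : 0 < c₀ * Λ ^ n).trans_le (hgr n x).1
      have h1 := exp_mul_backward_average_le hfin (ext2 T φ) f t n x hZ
      have h2 : Real.exp (t * f x) * (transferOp hfin (fun p => ext2 T φ p + t * f p.1) ^ n) 1 x /
          (L ^ n) 1 x ≤ K * Real.exp β ^ n := by
        calc _ ≤ Real.exp (t * f x) * (C * (Λ * Real.exp β) ^ n) / (c₀ * Λ ^ n) := by
              refine div_le_div₀ (by positivity) ?_ (by positivity) (hgr n x).1
              exact mul_le_mul_of_nonneg_left (h n x) (Real.exp_pos _).le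
          _ = K * Real.exp β ^ n := by
              rw [mul_pow, hK]
              field_simp
      have h3 := Real.log_le_log (Real.exp_pos _) (h1.trans h2)
      rwa [Real.log_exp, Real.log_mul hK0.ne' (by positivity), Real.log_pow, Real.log_exp] at h3
    have hlim : Tendsto (fun n : ℕ => (Real.log K - β) * (1 / ((n : ℝ) + 1)) + β) atTop
        (𝓝 ((Real.log K - β) * 0 + β)) :=
      (tendsto_one_div_add_atTop_nhds_zero_nat.const_mul _).add_const _
    have hετ : 0 < ε * τ := mul_pos hε hτ
    filter_upwards [hlim.eventually_lt_const
      (show (Real.log K - β) * 0 + β < t * c + 2 * ε * τ by linarith)] with n hn'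
    refine le_trans ?_ hn'.le
    have hn1 : (0 : ℝ) < n + 1 := by positivity
    have h4 : (Real.log K - β) * (1 / ((n : ℝ) + 1)) + β = (Real.log K + n * β) / (n + 1) := by
      field_simp
      ring
    rw [h4, le_div_iff₀ hn1]
    have := hn n
    linarith
  filter_upwards [havg τ (abs_of_pos hτ), havg (-τ) (by rw [abs_neg, abs_of_pos hτ])]
    with n h1 h2
  have h3 := hmean τ (abs_of_pos hτ)
  have h4 := hmean (-τ) (by rw [abs_neg, abs_of_pos hτ])
  have hτε : τ * (3 * ε) < τ * ε' := mul_lt_mul_of_pos_left hεε' hτ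
  rw [Real.dist_eq, abs_lt]
  constructor
  · refine lt_of_mul_lt_mul_left ?_ hτ.le
    linarith
  · refine lt_of_mul_lt_mul_left ?_ hτ.le
    linarith

end TimeAverages

theorem finsum_mem_backOrbits {X : Type*} {T : X → Set X} (hfin : ∀ x, {y | x ∈ T y}.Finite)
    {n : ℕ} {x : X} (F : (Fin (n + 1) → X) → ℝ) :
    ∑ᶠ y ∈ backOrbits T n x, F y = ∑ y ∈ (backOrbits_finite hfin n x).toFinset, F y :=
  finsum_mem_eq_finite_toFinset_sum F _

/-- **Theorem C, parts (a) and (b).** Equidistribution of backward orbits: for an open,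
strongly transitive, distance-expanding correspondence `T` and a Hölder potential `φ`,
with `μ_φ` the measure of the (unique) equilibrium state, (a) the time-averaged weighted
backward-orbit measures converge weak* to `μ_φ`; (b) if `T` is moreover topologically
exact then the weighted initial-point backward-orbit measures converge weak* to
`m_φ = ν ∘ π₁⁻¹`, where `ν` is the (unique) probability eigenmeasure of the dual Ruelle
operator: `∫ L_{φ̃}Φ dν = exp(P(T,φ)) ∫ Φ dν` for all continuous `Φ`. -/
theorem equidistribution_backward_orbits
    {X : Type*} [MetricSpace X] [CompactSpace X] [MeasurableSpace X] [BorelSpace X]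
    (T : X → Set X) (hT : IsCorrespondence T)
    (hopen : IsOpenCorr T) (htrans : StronglyTransitive T) (hdexp : DistanceExpanding T)
    (φ : ↥(graph2 T) → ℝ) (hφ : HolderOn T φ)
    (μφ : Measure X) (hμφ : ∃ Q : X → Measure X, IsEquilibrium T φ μφ Q) :
    (∀ x : X, ∀ f : X → ℝ, Continuous f →
      Tendsto (fun n : ℕ =>
          (∑ᶠ y ∈ backOrbits T n x,
              Real.exp (birkhoff T φ y) * ((∑ j : Fin (n + 1), f (y j)) / ((n : ℝ) + 1))) /
            ∑ᶠ y ∈ backOrbits T n x, Real.exp (birkhoff T φ y))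
        atTop (𝓝 (∫ a, f a ∂μφ))) ∧
    (TopologicallyExact T →
      ∀ ν : Measure ↥(orbitSpace T), IsProbabilityMeasure ν →
        (∀ Φ : ↥(orbitSpace T) → ℝ, Continuous Φ →
          ∫ z, ruelleL T φ Φ z ∂ν = Real.exp ((pressure T φ).toReal) * ∫ z, Φ z ∂ν) →
        ∀ x : X, ∀ f : X → ℝ, Continuous f →
          Tendsto (fun n : ℕ =>
              (∑ᶠ y ∈ backOrbits T n x, Real.exp (birkhoff T φ y) * f (y 0)) /
                ∑ᶠ y ∈ backOrbits T n x, Real.exp (birkhoff T φ y))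
            atTop (𝓝 (∫ a, f a ∂(ν.map fun z : ↥(orbitSpace T) => z.1 0)))) := by
  by_cases hne : Nonempty X
  swap
  · exact ⟨fun x => (hne ⟨x⟩).elim, fun _ _ _ _ x => (hne ⟨x⟩).elim⟩
  obtain ⟨η, hη, hsep⟩ := hdexp.exists_separation hT.1
  have hfin := finite_preimages hη hsep
  have hZ : ∀ (n : ℕ) (x : X), ∑ᶠ y ∈ backOrbits T n x, Real.exp (birkhoff T φ y) =
      (transferOp hfin (ext2 T φ) ^ n) 1 x := fun n x => by
    rw [finsum_mem_backOrbits hfin, transferOp_pow_one_apply]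
    rfl
  refine ⟨fun x f hf => ?_, fun hexact ν hν hνeig x f hf => ?_⟩
  · obtain ⟨Q, hQ⟩ := hμφ
    refine (hQ.tendsto_backward_average hT hopen htrans hdexp hφ hfin x hf).congr fun n => ?_
    rw [hZ, finsum_mem_backOrbits hfin]
    rfl
  · have hπ : Measurable fun z : ↥(orbitSpace T) => z.1 0 :=
      (measurable_pi_apply 0).comp measurable_subtype_coe
    have hπc : Continuous fun z : ↥(orbitSpace T) => z.1 0 :=
      (continuous_apply 0).comp continuous_subtype_val
    have hprob : IsProbabilityMeasure (ν.map fun z : ↥(orbitSpace T) => z.1 0) :=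
      Measure.isProbabilityMeasure_map hπ.aemeasurable
    have hLop := isTransferOp_transferOp hT hopen htrans hdexp hφ hfin
    have hlim := tendsto_ratio_of_eigenmeasure hLop
      (fun δ hδ => hexact.transferOp_lower_bound hT htrans.exists_preimage hφ hfin hδ)
      (ν.map fun z : ↥(orbitSpace T) => z.1 0) (Real.exp_pos (pressure T φ).toReal)
      (fun g hg => by
        rw [integral_map hπ.aemeasurable
            (hLop.continuous_apply hg).measurable.aestronglyMeasurable,
          integral_map hπ.aemeasurable hg.measurable.aestronglyMeasurable]
        have := hνeig (fun z => g (z.1 0)) (hg.comp hπc)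
        simpa only [ruelleL_comp_zero φ hfin] using this) hf x
    refine hlim.congr fun n => ?_
    rw [hZ, finsum_mem_backOrbits hfin, transferOp_pow_apply]
    rfl

end Corr
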